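/- arXiv:1902.03241 — 2 statements merged into one kernel-verified Lean document; each statement's English description precedes it below -/
import Mathlib

section
/- The double integral ∫_{ℝ^d} ∫_{ℝ^d} T₄(x,y)² dN(m₀,Σ₀)(x) dN(m₀,Σ₀)(y) equals det(V + 2σΣ₀)^{−1} · { 1 + 8σ² tr[((V + 2σΣ₀)^{−1}Σ₀)²] + 12σ⁴ (tr[((V + 2σΣ₀)^{−1}Σ₀)²])² + 24σ⁴ tr[((V + 2σΣ₀)^{−1}Σ₀)⁴] }. -/
open MeasureTheory Matrix Real

/-- The Gaussian probability measure `N(m, Σ)` on `ℝ^d`, given by its density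
`(2π)^{-d/2} det(Σ)^{-1/2} exp(-(x-m)ᵀ Σ⁻¹ (x-m) / 2)` with respect to Lebesgue measure. -/
noncomputable def gaussN {d : ℕ} (m : Fin d → ℝ) (S : Matrix (Fin d) (Fin d) ℝ) :
    Measure (Fin d → ℝ) :=
  MeasureTheory.volume.withDensity fun x =>
    ENNReal.ofReal ((2 * π) ^ (-(d : ℝ) / 2) * S.det ^ (-(1 : ℝ) / 2) *
      Real.exp (-((x - m) ⬝ᵥ (S⁻¹ *ᵥ (x - m))) / 2))

/-- `V = I_d + 2σΣ₀`. -/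
noncomputable def Vm {d : ℕ} (σ : ℝ) (S : Matrix (Fin d) (Fin d) ℝ) :
    Matrix (Fin d) (Fin d) ℝ :=
  1 + (2 * σ) • S

/-- `B(x) = (x−m₀)(x−m₀)ᵀ − Σ₀`. -/
noncomputable def Bm {d : ℕ} (m₀ : Fin d → ℝ) (S : Matrix (Fin d) (Fin d) ℝ)
    (x : Fin d → ℝ) : Matrix (Fin d) (Fin d) ℝ :=
  vecMulVec (x - m₀) (x - m₀) - S

/-- `T₁(x,y) = exp(−σ‖x−y‖²)`. -/
noncomputable def T1 {d : ℕ} (σ : ℝ) (x y : Fin d → ℝ) : ℝ :=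
  Real.exp (-σ * ((x - y) ⬝ᵥ (x - y)))

/-- `T₂(x,y) = det(V)^{−1/2} exp(−σ(x−m₀)ᵀV⁻¹(x−m₀)) ·
(1 + 2σ(x−m₀)ᵀV⁻¹(y−m₀) + σ tr[V⁻¹(2σ(B(x)+Σ₀)V⁻¹ − I_d)B(y)])`. -/
noncomputable def T2 {d : ℕ} (σ : ℝ) (m₀ : Fin d → ℝ) (S : Matrix (Fin d) (Fin d) ℝ)
    (x y : Fin d → ℝ) : ℝ :=
  (Vm σ S).det ^ (-(1 : ℝ) / 2) *
    Real.exp (-σ * ((x - m₀) ⬝ᵥ ((Vm σ S)⁻¹ *ᵥ (x - m₀)))) *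
    (1 + 2 * σ * ((x - m₀) ⬝ᵥ ((Vm σ S)⁻¹ *ᵥ (y - m₀))) +
      σ * ((Vm σ S)⁻¹ * ((2 * σ) • (Bm m₀ S x + S) * (Vm σ S)⁻¹ - 1) * Bm m₀ S y).trace)

/-- `T₃(x,y) = T₂(y,x)`. -/
noncomputable def T3 {d : ℕ} (σ : ℝ) (m₀ : Fin d → ℝ) (S : Matrix (Fin d) (Fin d) ℝ)
    (x y : Fin d → ℝ) : ℝ :=
  T2 σ m₀ S y x

/-- `T₄(x,y) = det(2V−I_d)^{−1/2} · (1 + σ tr[(2(x−m₀)(y−m₀)ᵀ − B(x) − B(y))(2V−I_d)⁻¹]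
+ σ²(tr[B(x)(2V−I_d)⁻¹]·tr[B(y)(2V−I_d)⁻¹] + 2 tr[B(x)(2V−I_d)⁻¹B(y)(2V−I_d)⁻¹]))`. -/
noncomputable def T4 {d : ℕ} (σ : ℝ) (m₀ : Fin d → ℝ) (S : Matrix (Fin d) (Fin d) ℝ)
    (x y : Fin d → ℝ) : ℝ :=
  ((2 : ℝ) • Vm σ S - 1).det ^ (-(1 : ℝ) / 2) *
    (1 + σ * (((2 : ℝ) • vecMulVec (x - m₀) (y - m₀) - Bm m₀ S x - Bm m₀ S y) *
        ((2 : ℝ) • Vm σ S - 1)⁻¹).trace +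
      σ ^ 2 * ((Bm m₀ S x * ((2 : ℝ) • Vm σ S - 1)⁻¹).trace *
          (Bm m₀ S y * ((2 : ℝ) • Vm σ S - 1)⁻¹).trace +
        2 * (Bm m₀ S x * ((2 : ℝ) • Vm σ S - 1)⁻¹ *
          Bm m₀ S y * ((2 : ℝ) • Vm σ S - 1)⁻¹).trace))

/-- `K(x,y) = T₁(x,y) − T₂(x,y) − T₃(x,y) + T₄(x,y)`. -/
noncomputable def Kf {d : ℕ} (σ : ℝ) (m₀ : Fin d → ℝ) (S : Matrix (Fin d) (Fin d) ℝ)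
    (x y : Fin d → ℝ) : ℝ :=
  T1 σ x y - T2 σ m₀ S x y - T3 σ m₀ S x y + T4 σ m₀ S x y

open ProbabilityTheory

/-- The standard Gaussian product measure on `ι → ℝ`. -/
noncomputable abbrev stdGauss (ι : Type*) [Fintype ι] : Measure (ι → ℝ) :=
  Measure.pi fun _ => gaussianReal 0 1

section ChangeOfVariables

lemma prod_gaussianPDFReal_zero_one {d : ℕ} (z : Fin d → ℝ) :
    ∏ i, gaussianPDFReal 0 1 (z i) = (2 * π) ^ (-(d : ℝ) / 2) * Real.exp (-(z ⬝ᵥ z) / 2) := by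
  have h : (0 : ℝ) ≤ 2 * π := by positivity
  simp only [gaussianPDFReal, NNReal.coe_one, mul_one, sub_zero, Finset.prod_mul_distrib,
    Finset.prod_const, Finset.card_univ, Fintype.card_fin, ← Real.exp_sum]
  congr 1
  · rw [Real.sqrt_eq_rpow, ← Real.rpow_neg h, ← Real.rpow_natCast, ← Real.rpow_mul h]
    congr 1
    ring
  · simp [dotProduct, ← Finset.sum_div, pow_two]

lemma stdGauss_eq_withDensity {ι : Type*} [Fintype ι] :
    stdGauss ι = volume.withDensity fun z => ENNReal.ofReal (∏ i, gaussianPDFReal 0 1 (z i)) := by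
  refine Measure.pi_eq fun s hs => ?_
  have hi : Integrable (fun z : ι → ℝ => ∏ i, gaussianPDFReal 0 1 (z i)) :=
    Integrable.fintype_prod fun _ => integrable_gaussianPDFReal 0 1
  rw [withDensity_apply _ (MeasurableSet.univ_pi hs),
    ← ofReal_integral_eq_lintegral_ofReal hi.restrict
      (ae_of_all _ fun z => Finset.prod_nonneg fun i _ => gaussianPDFReal_nonneg 0 1 (z i)),
    volume_pi, Measure.restrict_pi_pi, integral_fintype_prod_eq_prod,
    ENNReal.ofReal_prod_of_nonneg fun i _ =>
      integral_nonneg fun x => gaussianPDFReal_nonneg 0 1 x]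
  simp_rw [gaussianReal_apply_eq_integral 0 one_ne_zero]

lemma integral_stdGauss {d : ℕ} (f : (Fin d → ℝ) → ℝ) :
    ∫ z, f z ∂(stdGauss (Fin d)) =
      ∫ z, (2 * π) ^ (-(d : ℝ) / 2) * Real.exp (-(z ⬝ᵥ z) / 2) * f z := by
  have hm : Measurable fun z : Fin d → ℝ =>
      ENNReal.ofReal (∏ i, gaussianPDFReal 0 1 (z i)) := by
    simp_rw [prod_gaussianPDFReal_zero_one]
    exact (Continuous.measurable (by fun_prop)).ennreal_ofReal
  rw [stdGauss_eq_withDensity, integral_withDensity_eq_integral_toReal_smul hm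
    (ae_of_all _ fun _ => ENNReal.ofReal_lt_top)]
  refine integral_congr_ae (ae_of_all _ fun z => ?_)
  simp only [smul_eq_mul]
  rw [ENNReal.toReal_ofReal (Finset.prod_nonneg fun i _ => gaussianPDFReal_nonneg 0 1 (z i)),
    prod_gaussianPDFReal_zero_one]

lemma integral_comp_add_mulVec {d : ℕ} (f : (Fin d → ℝ) → ℝ) (m : Fin d → ℝ)
    {A : Matrix (Fin d) (Fin d) ℝ} (hA : A.det ≠ 0) :
    ∫ x, f x = |A.det| * ∫ z, f (m + A *ᵥ z) := by
  have hinj : Function.Injective (Matrix.toLin' A) := by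
    change Function.Injective A.mulVec
    rw [Matrix.mulVec_injective_iff_isUnit, Matrix.isUnit_iff_isUnit_det]
    exact hA.isUnit
  have hemb : MeasurableEmbedding (Matrix.toLin' A) :=
    ((LinearMap.isClosedEmbedding_of_injective
      (LinearMap.ker_eq_bot.2 hinj))).measurableEmbedding
  have h := hemb.integral_map (μ := volume) fun x => f (m + x)
  rw [Real.map_matrix_volume_pi_eq_smul_volume_pi hA, integral_smul_measure,
    integral_add_left_eq_self f m, ENNReal.toReal_ofReal (abs_nonneg _), smul_eq_mul] at h
  simp only [Matrix.toLin'_apply] at h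
  rw [← h, ← mul_assoc, ← abs_mul, mul_inv_cancel₀ hA, abs_one, one_mul]

lemma integral_gaussN {d : ℕ} (f : (Fin d → ℝ) → ℝ) (m : Fin d → ℝ)
    {A : Matrix (Fin d) (Fin d) ℝ} (hA : A.det ≠ 0) :
    ∫ x, f x ∂(gaussN m (A * Aᵀ)) = ∫ z, f (m + A *ᵥ z) ∂(stdGauss (Fin d)) := by
  have hdet : (A * Aᵀ).det = |A.det| ^ 2 := by rw [det_mul, det_transpose, sq_abs, sq]
  have hpos : 0 < |A.det| := abs_pos.2 hA
  have hc : |A.det| * (|A.det| ^ 2) ^ (-(1 : ℝ) / 2) = 1 := by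
    rw [← Real.rpow_natCast, ← Real.rpow_mul hpos.le]
    norm_num [Real.rpow_neg_one, hpos.ne']
  have hq (z : Fin d → ℝ) : (A *ᵥ z) ⬝ᵥ ((A * Aᵀ)⁻¹ *ᵥ (A *ᵥ z)) = z ⬝ᵥ z := by
    have h1 : Aᵀ * ((A * Aᵀ)⁻¹ * A) = 1 := by
      rw [Matrix.mul_inv_rev, Matrix.mul_assoc, Matrix.nonsing_inv_mul _ hA.isUnit,
        Matrix.mul_one, Matrix.mul_nonsing_inv _ (by rw [det_transpose]; exact hA.isUnit)]
    rw [Matrix.mulVec_mulVec, ← Matrix.vecMul_transpose, ← Matrix.dotProduct_mulVec,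
      Matrix.mulVec_mulVec, h1, Matrix.one_mulVec]
  have hm : Measurable fun x : Fin d → ℝ => ENNReal.ofReal ((2 * π) ^ (-(d : ℝ) / 2) *
      (A * Aᵀ).det ^ (-(1 : ℝ) / 2) *
        Real.exp (-((x - m) ⬝ᵥ ((A * Aᵀ)⁻¹ *ᵥ (x - m))) / 2)) :=
    (Continuous.measurable (by fun_prop)).ennreal_ofReal
  rw [gaussN, integral_withDensity_eq_integral_toReal_smul hm
    (ae_of_all _ fun _ => ENNReal.ofReal_lt_top), integral_comp_add_mulVec _ m hA,
    integral_stdGauss, ← integral_const_mul]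
  refine integral_congr_ae (ae_of_all _ fun z => ?_)
  simp only [smul_eq_mul, add_sub_cancel_left, hq, hdet]
  rw [ENNReal.toReal_ofReal (by positivity)]
  linear_combination ((2 * π) ^ (-(d : ℝ) / 2) * Real.exp (-(z ⬝ᵥ z) / 2) * f (m + A *ᵥ z)) * hc

end ChangeOfVariables

section HermiteTwo

variable {ι : Type*} [DecidableEq ι]

/-- The matrix of second Hermite polynomials, `z zᵀ - 1`. -/
def hermiteTwo (z : ι → ℝ) : Matrix ι ι ℝ :=
  vecMulVec z z - 1

lemma hermiteTwo_apply (z : ι → ℝ) (i j : ι) :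
    hermiteTwo z i j = z i * z j - (1 : Matrix ι ι ℝ) i j := rfl

lemma hermiteTwo_transpose (z : ι → ℝ) : (hermiteTwo z)ᵀ = hermiteTwo z := by
  simp [hermiteTwo, transpose_vecMulVec]

lemma hermiteTwo_neg (z : ι → ℝ) : hermiteTwo (-z) = hermiteTwo z := by
  ext i j
  simp [hermiteTwo_apply]

end HermiteTwo

section Moments

lemma integral_pow_gaussianReal (n : ℕ) :
    ∫ x, x ^ n ∂(gaussianReal 0 1) = iteratedDeriv n (fun t => Real.exp (t ^ 2 / 2)) 0 := by
  have h := iteratedDeriv_mgf_zero (X := fun x : ℝ => x) (μ := gaussianReal 0 1) (by simp) n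
  rw [mgf_fun_id_gaussianReal] at h
  simpa using h.symm

lemma iteratedDeriv_exp_sq_half_succ {f p q : ℝ → ℝ} {n : ℕ}
    (h : iteratedDeriv n f = fun t => p t * Real.exp (t ^ 2 / 2))
    (hp : ∀ t, HasDerivAt p (q t) t) :
    iteratedDeriv (n + 1) f = fun t => (q t + t * p t) * Real.exp (t ^ 2 / 2) := by
  ext t
  rw [iteratedDeriv_succ, h]
  have he : HasDerivAt (fun t : ℝ => t ^ 2 / 2) t t := by
    simpa using (hasDerivAt_pow 2 t).div_const 2
  rw [((hp t).fun_mul he.exp).deriv]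
  ring

lemma iteratedDeriv_two_exp_sq_half :
    iteratedDeriv 2 (fun t : ℝ => Real.exp (t ^ 2 / 2)) =
      fun t => (1 + t ^ 2) * Real.exp (t ^ 2 / 2) := by
  have h0 : iteratedDeriv 0 (fun t : ℝ => Real.exp (t ^ 2 / 2)) =
      fun t => 1 * Real.exp (t ^ 2 / 2) := by simp
  have h1 := iteratedDeriv_exp_sq_half_succ h0 fun t => hasDerivAt_const t 1
  have h2 := iteratedDeriv_exp_sq_half_succ (q := fun _ => 1) h1 fun t => by
    simpa using hasDerivAt_id' t
  rw [h2]
  ext t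
  ring

lemma iteratedDeriv_four_exp_sq_half :
    iteratedDeriv 4 (fun t : ℝ => Real.exp (t ^ 2 / 2)) =
      fun t => (3 + 6 * t ^ 2 + t ^ 4) * Real.exp (t ^ 2 / 2) := by
  have h3 := iteratedDeriv_exp_sq_half_succ (q := fun t => 2 * t)
    iteratedDeriv_two_exp_sq_half fun t => by simpa using (hasDerivAt_pow 2 t).const_add 1
  have h4 := iteratedDeriv_exp_sq_half_succ (q := fun t => 3 + 3 * t ^ 2) h3 fun t => by
    have h := ((hasDerivAt_id' t).const_mul 2).add
      ((hasDerivAt_id' t).mul ((hasDerivAt_pow 2 t).const_add 1))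
    refine h.congr_deriv ?_
    simp
    ring
  rw [h4]
  ext t
  ring

lemma integral_sq_gaussianReal : ∫ x, x ^ 2 ∂(gaussianReal 0 1) = 1 := by
  simp [integral_pow_gaussianReal, iteratedDeriv_two_exp_sq_half]

lemma integral_pow_four_gaussianReal : ∫ x, x ^ 4 ∂(gaussianReal 0 1) = 3 := by
  simp [integral_pow_gaussianReal, iteratedDeriv_four_exp_sq_half]

variable {ι : Type*} [Fintype ι]

/-- Random variables on the standard Gaussian space all of whose moments are finite. -/
def HasAllMoments (f : (ι → ℝ) → ℝ) : Prop :=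
  ∀ n : ℕ, MemLp f n (stdGauss ι)

namespace HasAllMoments

variable {f g : (ι → ℝ) → ℝ}

lemma integrable (hf : HasAllMoments f) : Integrable f (stdGauss ι) :=
  memLp_one_iff_integrable.1 (by simpa using hf 1)

lemma const (c : ℝ) : HasAllMoments fun _ : ι → ℝ => c :=
  fun _ => memLp_const c

lemma add (hf : HasAllMoments f) (hg : HasAllMoments g) : HasAllMoments fun z => f z + g z :=
  fun n => (hf n).add (hg n)

lemma sub (hf : HasAllMoments f) (hg : HasAllMoments g) : HasAllMoments fun z => f z - g z :=
  fun n => (hf n).sub (hg n)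

lemma mul (hf : HasAllMoments f) (hg : HasAllMoments g) : HasAllMoments fun z => f z * g z := by
  intro n
  have : ENNReal.HolderTriple ((2 * n : ℕ) : ENNReal) ((2 * n : ℕ) : ENNReal) (n : ENNReal) := by
    constructor
    push_cast
    rw [ENNReal.mul_inv (by simp) (by simp), ← add_mul, ENNReal.inv_two_add_inv_two, one_mul]
  exact (hg (2 * n)).mul (hf (2 * n))

lemma pow_two (hf : HasAllMoments f) : HasAllMoments fun z => f z ^ 2 := by
  simpa only [sq] using hf.mul hf

lemma sum {κ : Type*} {s : Finset κ} {F : κ → (ι → ℝ) → ℝ} (hF : ∀ k, HasAllMoments (F k)) :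
    HasAllMoments fun z => ∑ k ∈ s, F k z :=
  fun n => memLp_finsetSum s fun k _ => hF k n

lemma coord (i : ι) : HasAllMoments fun z : ι → ℝ => z i := fun n =>
  (memLp_id_gaussianReal' (μ := 0) (v := 1) n (by simp)).comp_measurePreserving
    (measurePreserving_eval (fun _ : ι => gaussianReal 0 1) i)

end HasAllMoments

lemma integral_eq_zero_of_sign {f : (ι → ℝ) → ℝ} (ε : ι → ℝ) (hε : ∀ i, ε i = 1 ∨ ε i = -1)
    (hf : ∀ z, f (ε * z) = -f z) : ∫ z, f z ∂(stdGauss ι) = 0 := by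
  have hmp : MeasurePreserving (fun z : ι → ℝ => ε * z) (stdGauss ι) (stdGauss ι) := by
    refine measurePreserving_pi _ _ (f := fun i x => ε i * x) fun i =>
      ⟨measurable_const_mul _, ?_⟩
    rw [gaussianReal_map_const_mul]
    congr 1
    · simp
    · ext
      rcases hε i with h | h <;> simp [h]
  have hinv : Function.Involutive fun z : ι → ℝ => ε * z := fun z => by
    ext i
    rcases hε i with h | h <;> simp [h]
  have hemb : MeasurableEmbedding fun z : ι → ℝ => ε * z :=
    (MeasurableEquiv.ofInvolutive _ hinv hmp.measurable).measurableEmbedding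
  have h := hmp.integral_comp hemb f
  simp only [hf, integral_neg] at h
  linarith

lemma integral_eq_zero_of_odd {f : (ι → ℝ) → ℝ} (hf : ∀ z, f (-z) = -f z) :
    ∫ z, f z ∂(stdGauss ι) = 0 :=
  integral_eq_zero_of_sign (-1) (fun _ => Or.inr rfl) (by simpa using hf)

lemma integral_prod_pow (n : ι → ℕ) :
    ∫ z, ∏ m, z m ^ n m ∂(stdGauss ι) = ∏ m, ∫ x, x ^ n m ∂(gaussianReal 0 1) :=
  integral_fintype_prod_eq_prod fun m x => x ^ n m

lemma integral_coord_pow (i : ι) (n : ℕ) :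
    ∫ z, z i ^ n ∂(stdGauss ι) = ∫ x, x ^ n ∂(gaussianReal 0 1) := by
  have h := measurePreserving_eval (fun _ : ι => gaussianReal 0 1) i
  rw [← h.map_eq, integral_map h.measurable.aemeasurable (by fun_prop)]

variable [DecidableEq ι]

lemma integral_eq_zero_of_flip {f : (ι → ℝ) → ℝ} (i : ι)
    (hf : ∀ z, f ((fun m => if m = i then -1 else 1) * z) = -f z) :
    ∫ z, f z ∂(stdGauss ι) = 0 :=
  integral_eq_zero_of_sign _ (fun m => by split_ifs <;> simp) hf

lemma integral_coord_mul (i j : ι) :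
    ∫ z, z i * z j ∂(stdGauss ι) = (1 : Matrix ι ι ℝ) i j := by
  by_cases h : i = j
  · subst h
    simp_rw [← sq, integral_coord_pow, integral_sq_gaussianReal, Matrix.one_apply_eq]
  · rw [Matrix.one_apply_ne h]
    exact integral_eq_zero_of_flip i fun z => by simp [Ne.symm h]

lemma integral_sq_mul_sq {i k : ι} (h : i ≠ k) :
    ∫ z, z i ^ 2 * z k ^ 2 ∂(stdGauss ι) = 1 := by
  have hp (z : ι → ℝ) : z i ^ 2 * z k ^ 2 =
      ∏ m, z m ^ (if m = i then 2 else if m = k then 2 else 0) := by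
    rw [Fintype.prod_eq_mul i k h fun m hm => by simp [hm.1, hm.2]]
    simp [h.symm]
  simp_rw [hp, integral_prod_pow]
  refine Finset.prod_eq_one fun m _ => ?_
  split_ifs <;> simp [integral_sq_gaussianReal]

lemma integral_coord_mul_four_of_eq (i k l : ι) :
    ∫ z, z i * z i * z k * z l ∂(stdGauss ι) =
      (1 : Matrix ι ι ℝ) k l + 2 * ((1 : Matrix ι ι ℝ) i k * (1 : Matrix ι ι ℝ) i l) := by
  by_cases hkl : k = l
  · subst hkl
    by_cases hik : i = k
    · subst hik
      have h (z : ι → ℝ) : z i * z i * z i * z i = z i ^ 4 := by ring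
      simp_rw [h, integral_coord_pow, integral_pow_four_gaussianReal]
      norm_num
    · have h (z : ι → ℝ) : z i * z i * z k * z k = z i ^ 2 * z k ^ 2 := by ring
      simp_rw [h, integral_sq_mul_sq hik]
      simp [hik]
  · by_cases hik : i = k
    · subst hik
      rw [integral_eq_zero_of_flip l fun z => by simp [hkl]]
      simp [hkl]
    · rw [integral_eq_zero_of_flip k fun z => by simp [hik, Ne.symm hkl]]
      simp [hik, hkl]

/-- Isserlis' formula for fourth moments. -/
lemma integral_coord_mul_four (i j k l : ι) :
    ∫ z, z i * z j * z k * z l ∂(stdGauss ι) =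
      (1 : Matrix ι ι ℝ) i j * (1 : Matrix ι ι ℝ) k l +
        (1 : Matrix ι ι ℝ) i k * (1 : Matrix ι ι ℝ) j l +
        (1 : Matrix ι ι ℝ) i l * (1 : Matrix ι ι ℝ) j k := by
  by_cases hij : i = j
  · subst hij
    rw [integral_coord_mul_four_of_eq, Matrix.one_apply_eq]
    ring
  by_cases hik : i = k
  · subst hik
    have h (z : ι → ℝ) : z i * z j * z i * z l = z i * z i * z j * z l := by ring
    simp_rw [h, integral_coord_mul_four_of_eq]
    simp [hij, Ne.symm hij]
  by_cases hil : i = l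
  · subst hil
    have h (z : ι → ℝ) : z i * z j * z k * z i = z i * z i * z j * z k := by ring
    simp_rw [h, integral_coord_mul_four_of_eq]
    simp [hij, hik]
  rw [integral_eq_zero_of_flip i fun z => by simp [Ne.symm hij, Ne.symm hik, Ne.symm hil]]
  simp [hij, hik, hil]

lemma HasAllMoments.hermiteTwo (i j : ι) : HasAllMoments fun z : ι → ℝ => hermiteTwo z i j :=
  ((coord i).mul (coord j)).sub (const _)

lemma integral_hermiteTwo (i j : ι) : ∫ z, hermiteTwo z i j ∂(stdGauss ι) = 0 := by
  simp_rw [hermiteTwo_apply]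
  rw [integral_sub ((HasAllMoments.coord i).mul (.coord j)).integrable (integrable_const _),
    integral_coord_mul]
  simp

lemma integral_hermiteTwo_mul (i j k l : ι) :
    ∫ z, hermiteTwo z i j * hermiteTwo z k l ∂(stdGauss ι) =
      (1 : Matrix ι ι ℝ) i k * (1 : Matrix ι ι ℝ) j l +
        (1 : Matrix ι ι ℝ) i l * (1 : Matrix ι ι ℝ) j k := by
  have h (z : ι → ℝ) : hermiteTwo z i j * hermiteTwo z k l =
      z i * z j * z k * z l - (1 : Matrix ι ι ℝ) k l * hermiteTwo z i j -
        (1 : Matrix ι ι ℝ) i j * hermiteTwo z k l -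
        (1 : Matrix ι ι ℝ) i j * (1 : Matrix ι ι ℝ) k l := by
    simp only [hermiteTwo_apply]
    ring
  have h4 : HasAllMoments fun z : ι → ℝ => z i * z j * z k * z l :=
    (((HasAllMoments.coord i).mul (.coord j)).mul (.coord k)).mul (.coord l)
  have h2 (c : ℝ) (a b : ι) : HasAllMoments fun z : ι → ℝ => c * hermiteTwo z a b :=
    (HasAllMoments.const c).mul (.hermiteTwo a b)
  simp_rw [h]
  rw [integral_sub ((h4.sub (h2 _ i j)).sub (h2 _ k l)).integrable (integrable_const _),
    integral_sub (h4.sub (h2 _ i j)).integrable (h2 _ k l).integrable,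
    integral_sub h4.integrable (h2 _ i j).integrable, integral_const_mul, integral_const_mul,
    integral_hermiteTwo, integral_hermiteTwo, integral_coord_mul_four]
  simp
  ring

lemma integral_sq_linear (b : ι → ℝ) :
    ∫ z, (∑ i, b i * z i) ^ 2 ∂(stdGauss ι) = ∑ i, b i ^ 2 := by
  have hi (i j : ι) : Integrable (fun z : ι → ℝ => (b i * z i) * (b j * z j)) (stdGauss ι) :=
    (((HasAllMoments.const _).mul (.coord i)).mul
      ((HasAllMoments.const _).mul (.coord j))).integrable
  simp_rw [sq (∑ i, _ * _), Finset.sum_mul_sum]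
  rw [integral_finsetSum _ fun i _ => integrable_finsetSum _ fun j _ => hi i j]
  simp_rw [integral_finsetSum _ fun j _ => hi _ j, mul_mul_mul_comm, integral_const_mul,
    integral_coord_mul]
  simp [Matrix.one_apply, sq]

lemma integral_sq_quadratic (Q : ι → ι → ℝ) :
    ∫ z, (∑ i, ∑ j, Q i j * hermiteTwo z i j) ^ 2 ∂(stdGauss ι) =
      ∑ i, ∑ j, (Q i j ^ 2 + Q i j * Q j i) := by
  have hi (p q : ι × ι) : Integrable (fun z : ι → ℝ =>
      (Q p.1 p.2 * hermiteTwo z p.1 p.2) * (Q q.1 q.2 * hermiteTwo z q.1 q.2)) (stdGauss ι) :=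
    (((HasAllMoments.const _).mul (.hermiteTwo p.1 p.2)).mul
      ((HasAllMoments.const _).mul (.hermiteTwo q.1 q.2))).integrable
  simp_rw [← Fintype.sum_prod_type']
  simp_rw [sq (∑ p : ι × ι, _ * _), Finset.sum_mul_sum]
  rw [integral_finsetSum _ fun i _ => integrable_finsetSum _ fun j _ => hi i j]
  simp_rw [integral_finsetSum _ fun j _ => hi _ j, mul_mul_mul_comm, integral_const_mul,
    integral_hermiteTwo_mul]
  refine Finset.sum_congr rfl fun p _ => ?_
  simp [Fintype.sum_prod_type, Matrix.one_apply, mul_add, Finset.sum_add_distrib, sq]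

/-- Orthogonality of the Hermite polynomials of degree at most two. -/
lemma integral_sq_add_linear_add_quadratic (a : ℝ) (b : ι → ℝ) (Q : ι → ι → ℝ) :
    ∫ z, (a + ∑ i, b i * z i + ∑ i, ∑ j, Q i j * hermiteTwo z i j) ^ 2 ∂(stdGauss ι) =
      a ^ 2 + ∑ i, b i ^ 2 + ∑ i, ∑ j, (Q i j ^ 2 + Q i j * Q j i) := by
  set L : (ι → ℝ) → ℝ := fun z => ∑ i, b i * z i with hL
  set G : (ι → ℝ) → ℝ := fun z => ∑ i, ∑ j, Q i j * hermiteTwo z i j with hG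
  have mL : HasAllMoments L := .sum fun i => (HasAllMoments.const _).mul (.coord i)
  have mG : HasAllMoments G :=
    .sum fun i => .sum fun j => (HasAllMoments.const _).mul (.hermiteTwo i j)
  have hneg (z : ι → ℝ) : L (-z) = -L z := by simp [hL]
  have iL : ∫ z, L z * (2 * a + 2 * G z) ∂(stdGauss ι) = 0 :=
    integral_eq_zero_of_odd fun z => by rw [hneg]; simp [hG, hermiteTwo_neg]
  have iG : ∫ z, G z ∂(stdGauss ι) = 0 := by
    have hi (i j : ι) : HasAllMoments fun z : ι → ℝ => Q i j * hermiteTwo z i j :=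
      (HasAllMoments.const _).mul (.hermiteTwo i j)
    simp only [hG]
    rw [integral_finsetSum _ fun i _ => (HasAllMoments.sum (hi i)).integrable]
    simp_rw [integral_finsetSum _ fun j _ => (hi _ j).integrable, integral_const_mul,
      integral_hermiteTwo]
    simp
  have hexp (z : ι → ℝ) : (a + L z + G z) ^ 2 =
      a ^ 2 + L z ^ 2 + G z ^ 2 + L z * (2 * a + 2 * G z) + 2 * a * G z := by ring
  have m1 : HasAllMoments fun z => a ^ 2 + L z ^ 2 := (HasAllMoments.const _).add mL.pow_two
  have m2 := m1.add mG.pow_two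
  have m3 : HasAllMoments fun z => L z * (2 * a + 2 * G z) :=
    mL.mul ((HasAllMoments.const _).add ((HasAllMoments.const _).mul mG))
  have m4 : HasAllMoments fun z => 2 * a * G z := (HasAllMoments.const _).mul mG
  change ∫ z, (a + L z + G z) ^ 2 ∂(stdGauss ι) = _
  simp_rw [hexp]
  rw [integral_add (m2.add m3).integrable m4.integrable, integral_add m2.integrable m3.integrable,
    integral_add m1.integrable mG.pow_two.integrable,
    integral_add (integrable_const _) mL.pow_two.integrable, iL, integral_const_mul, iG,
    integral_sq_linear, integral_sq_quadratic]
  simp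

end Moments

section DoubleIntegral

variable {ι : Type*} [Fintype ι] {M : Matrix ι ι ℝ}

lemma trace_mul_eq_sum (hM : Mᵀ = M) (H : Matrix ι ι ℝ) :
    (H * M).trace = ∑ i, ∑ j, M i j * H i j := by
  simp only [Matrix.trace, Matrix.diag, Matrix.mul_apply]
  exact Finset.sum_congr rfl fun i _ => Finset.sum_congr rfl fun j _ => by
    rw [show M j i = M i j from congr_fun₂ hM i j, mul_comm]

variable [DecidableEq ι]

lemma sum_sq_eq_trace (hM : Mᵀ = M) : ∑ i, ∑ j, M i j ^ 2 = (M ^ 2).trace := by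
  simp only [sq, Matrix.trace, Matrix.diag, Matrix.mul_apply]
  exact Finset.sum_congr rfl fun i _ => Finset.sum_congr rfl fun j _ => by
    rw [show M j i = M i j from congr_fun₂ hM i j]

lemma sum_cycle_eq_trace_pow_four (M : Matrix ι ι ℝ) :
    ∑ i, ∑ j, ∑ k, ∑ l, M i j * M j k * M k l * M l i = (M ^ 4).trace := by
  rw [show M ^ 4 = M * (M * (M * M)) by noncomm_ring]
  simp only [Matrix.trace, Matrix.diag, Matrix.mul_apply, Finset.mul_sum, mul_assoc]

lemma sum_quadratic_coeff (hM : Mᵀ = M) :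
    ∑ i, ∑ j, ∑ k, ∑ l, ((M i j * M k l + 2 * (M i k * M j l)) ^ 2 +
      (M i j * M k l + 2 * (M i k * M j l)) * (M i j * M l k + 2 * (M i l * M j k))) =
      6 * (M ^ 2).trace ^ 2 + 12 * (M ^ 4).trace := by
  have hs (i j : ι) : M j i = M i j := congr_fun₂ hM i j
  have e1 : ∑ i, ∑ j, ∑ k, ∑ l, M i j ^ 2 * M k l ^ 2 = (M ^ 2).trace ^ 2 := by
    rw [← sum_sq_eq_trace hM, sq (∑ i, _)]
    simp only [Finset.sum_mul]
    simp only [Finset.mul_sum]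
  have e2 : ∑ i, ∑ j, ∑ k, ∑ l, M i k ^ 2 * M j l ^ 2 = (M ^ 2).trace ^ 2 := by
    rw [← e1]
    exact Finset.sum_congr rfl fun i _ => Finset.sum_comm
  have e3 := sum_cycle_eq_trace_pow_four M
  have e4 : ∑ i, ∑ j, ∑ k, ∑ l, M i j * M j l * M l k * M k i = (M ^ 4).trace := by
    rw [← e3]
    exact Finset.sum_congr rfl fun i _ => Finset.sum_congr rfl fun j _ => Finset.sum_comm
  have e5 : ∑ i, ∑ j, ∑ k, ∑ l, M i k * M k j * M j l * M l i = (M ^ 4).trace := by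
    rw [← e3]
    exact Finset.sum_congr rfl fun i _ => Finset.sum_comm
  have hexp (i j k l : ι) : (M i j * M k l + 2 * (M i k * M j l)) ^ 2 +
      (M i j * M k l + 2 * (M i k * M j l)) * (M i j * M l k + 2 * (M i l * M j k)) =
      2 * (M i j ^ 2 * M k l ^ 2) + 4 * (M i k ^ 2 * M j l ^ 2) +
        2 * (M i j * M j k * M k l * M l i) + 6 * (M i j * M j l * M l k * M k i) +
        4 * (M i k * M k j * M j l * M l i) := by
    rw [hs k l, hs i l, hs i k, hs j k]
    ring
  have hlin (c : ℝ) (F : ι → ι → ι → ι → ℝ) :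
      ∑ i, ∑ j, ∑ k, ∑ l, c * F i j k l = c * ∑ i, ∑ j, ∑ k, ∑ l, F i j k l := by
    simp_rw [Finset.mul_sum]
  simp_rw [hexp, Finset.sum_add_distrib, hlin, e1, e2, e3, e4, e5]
  ring

/-- The polynomial factor of `T₄` in coordinates that standardise the Gaussian measure. -/
noncomputable def stdKernel (σ : ℝ) (M : Matrix ι ι ℝ) (z w : ι → ℝ) : ℝ :=
  1 + σ * (2 * (z ⬝ᵥ (M *ᵥ w)) - (hermiteTwo z * M).trace - (hermiteTwo w * M).trace) +
    σ ^ 2 * ((hermiteTwo z * M).trace * (hermiteTwo w * M).trace +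
      2 * (hermiteTwo z * M * hermiteTwo w * M).trace)

/-- The coefficient of `stdKernel` on the second Hermite polynomials in its first variable. -/
noncomputable def stdKernelQuad (σ : ℝ) (M : Matrix ι ι ℝ) (w : ι → ℝ) (i j : ι) : ℝ :=
  -σ * M i j + ∑ k, 0 * w k +
    ∑ k, ∑ l, σ ^ 2 * (M i j * M k l + 2 * (M i k * M j l)) * hermiteTwo w k l

lemma stdKernelQuad_eq (hM : Mᵀ = M) (σ : ℝ) (w : ι → ℝ) (i j : ι) :
    stdKernelQuad σ M w i j =
      (-σ + σ ^ 2 * (hermiteTwo w * M).trace) * M i j +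
        2 * σ ^ 2 * (M * hermiteTwo w * M) i j := by
  have h1 : (M * hermiteTwo w * M) i j = ∑ k, ∑ l, M i k * M j l * hermiteTwo w k l := by
    simp only [Matrix.mul_apply, Finset.sum_mul]
    rw [Finset.sum_comm]
    exact Finset.sum_congr rfl fun k _ => Finset.sum_congr rfl fun l _ => by
      rw [show M l j = M j l from congr_fun₂ hM j l]; ring
  have h2 (k l : ι) : σ ^ 2 * (M i j * M k l + 2 * (M i k * M j l)) * hermiteTwo w k l =
      σ ^ 2 * M i j * (M k l * hermiteTwo w k l) +
        2 * σ ^ 2 * (M i k * M j l * hermiteTwo w k l) := by ring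
  simp_rw [stdKernelQuad, h2, Finset.sum_add_distrib, ← Finset.mul_sum, ← h1,
    ← trace_mul_eq_sum hM]
  simp
  ring

lemma stdKernelQuad_symm (hM : Mᵀ = M) (σ : ℝ) (w : ι → ℝ) (i j : ι) :
    stdKernelQuad σ M w j i = stdKernelQuad σ M w i j := by
  have h : (M * hermiteTwo w * M)ᵀ = M * hermiteTwo w * M := by
    simp only [transpose_mul, hM, hermiteTwo_transpose, Matrix.mul_assoc]
  rw [stdKernelQuad_eq hM, stdKernelQuad_eq hM, show M j i = M i j from congr_fun₂ hM i j,
    show (M * hermiteTwo w * M) j i = _ from congr_fun₂ h i j]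

lemma stdKernel_eq_hermite (hM : Mᵀ = M) (σ : ℝ) (z w : ι → ℝ) :
    stdKernel σ M z w =
      (1 + ∑ k, 0 * w k + ∑ k, ∑ l, -σ * M k l * hermiteTwo w k l) +
        ∑ i, (∑ k, 2 * σ * M i k * w k) * z i +
        ∑ i, ∑ j, stdKernelQuad σ M w i j * hermiteTwo z i j := by
  have h1 : z ⬝ᵥ (M *ᵥ w) = ∑ i, (∑ k, M i k * w k) * z i := by
    simp [dotProduct, Matrix.mulVec, mul_comm]
  have h2 : (hermiteTwo z * M * hermiteTwo w * M).trace =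
      ∑ i, ∑ j, (M * hermiteTwo w * M) i j * hermiteTwo z i j := by
    rw [← trace_mul_eq_sum (by simp only [transpose_mul, hM, hermiteTwo_transpose,
      Matrix.mul_assoc])]
    simp only [Matrix.mul_assoc]
  have h3 (i j : ι) : stdKernelQuad σ M w i j * hermiteTwo z i j =
      (-σ + σ ^ 2 * (hermiteTwo w * M).trace) * (M i j * hermiteTwo z i j) +
        2 * σ ^ 2 * ((M * hermiteTwo w * M) i j * hermiteTwo z i j) := by
    rw [stdKernelQuad_eq hM]
    ring
  have h4 : ∑ i, (∑ k, 2 * σ * M i k * w k) * z i = 2 * σ * ∑ i, (∑ k, M i k * w k) * z i := by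
    simp only [Finset.mul_sum, Finset.sum_mul, mul_assoc]
  have hlin (c : ℝ) (F : ι → ι → ℝ) : ∑ i, ∑ j, c * F i j = c * ∑ i, ∑ j, F i j := by
    simp_rw [Finset.mul_sum]
  simp_rw [h3, h4, Finset.sum_add_distrib, mul_assoc (-σ), hlin, ← h2, ← trace_mul_eq_sum hM,
    stdKernel, h1]
  simp
  ring

lemma integral_stdKernel_sq (hM : Mᵀ = M) (σ : ℝ) (w : ι → ℝ) :
    ∫ z, stdKernel σ M z w ^ 2 ∂(stdGauss ι) =
      (1 + ∑ k, 0 * w k + ∑ k, ∑ l, -σ * M k l * hermiteTwo w k l) ^ 2 +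
        ∑ i, (∑ k, 2 * σ * M i k * w k) ^ 2 +
        ∑ i, ∑ j, 2 * stdKernelQuad σ M w i j ^ 2 := by
  simp_rw [stdKernel_eq_hermite hM, integral_sq_add_linear_add_quadratic]
  congr 1
  refine Finset.sum_congr rfl fun i _ => Finset.sum_congr rfl fun j _ => ?_
  rw [stdKernelQuad_symm hM σ w i j]
  ring

lemma HasAllMoments.quadratic (a : ℝ) (b : ι → ℝ) (Q : ι → ι → ℝ) :
    HasAllMoments fun z => a + ∑ i, b i * z i + ∑ i, ∑ j, Q i j * _root_.hermiteTwo z i j :=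
  ((const a).add (.sum fun i => (const _).mul (coord i))).add
    (.sum fun i => .sum fun j => (const _).mul (.hermiteTwo i j))

lemma integral_integral_stdKernel_sq (hM : Mᵀ = M) (σ : ℝ) :
    ∫ w, (∫ z, stdKernel σ M z w ^ 2 ∂(stdGauss ι)) ∂(stdGauss ι) =
      1 + 8 * σ ^ 2 * (M ^ 2).trace + 12 * σ ^ 4 * (M ^ 2).trace ^ 2 +
        24 * σ ^ 4 * (M ^ 4).trace := by
  have ha := (HasAllMoments.quadratic 1 0 fun k l => -σ * M k l).pow_two
  have hb (i : ι) : HasAllMoments fun w : ι → ℝ => (∑ k, 2 * σ * M i k * w k) ^ 2 :=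
    (HasAllMoments.sum fun k => (HasAllMoments.const _).mul (.coord k)).pow_two
  have hQ (i j : ι) : HasAllMoments fun w => 2 * stdKernelQuad σ M w i j ^ 2 :=
    (HasAllMoments.const 2).mul (HasAllMoments.quadratic (-σ * M i j) 0 fun k l =>
      σ ^ 2 * (M i j * M k l + 2 * (M i k * M j l))).pow_two
  have hs (i j : ι) : M j i = M i j := congr_fun₂ hM i j
  have t := sum_sq_eq_trace hM
  have ia := integral_sq_add_linear_add_quadratic 1 0 fun k l => -σ * M k l
  have iQ (i j : ι) := integral_sq_add_linear_add_quadratic (-σ * M i j) 0 fun k l =>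
    σ ^ 2 * (M i j * M k l + 2 * (M i k * M j l))
  have ea : ∑ k, ∑ l, ((-σ * M k l) ^ 2 + -σ * M k l * (-σ * M l k)) =
      2 * σ ^ 2 * (M ^ 2).trace := by
    rw [← t]
    simp_rw [Finset.mul_sum]
    exact Finset.sum_congr rfl fun k _ => Finset.sum_congr rfl fun l _ => by rw [hs k l]; ring
  have eb : ∑ i, ∑ k, (2 * σ * M i k) ^ 2 = 4 * σ ^ 2 * (M ^ 2).trace := by
    rw [← t]
    simp_rw [Finset.mul_sum]
    exact Finset.sum_congr rfl fun k _ => Finset.sum_congr rfl fun l _ => by ring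
  have eQ : ∑ i, ∑ j, 2 * ((-σ * M i j) ^ 2 + ∑ k, (0 : ι → ℝ) k ^ 2 +
      ∑ k, ∑ l, ((σ ^ 2 * (M i j * M k l + 2 * (M i k * M j l))) ^ 2 +
        σ ^ 2 * (M i j * M k l + 2 * (M i k * M j l)) *
          (σ ^ 2 * (M i j * M l k + 2 * (M i l * M j k))))) =
      2 * σ ^ 2 * (M ^ 2).trace + 2 * σ ^ 4 * (6 * (M ^ 2).trace ^ 2 + 12 * (M ^ 4).trace) := by
    rw [← sum_quadratic_coeff hM, ← t]
    simp_rw [Finset.mul_sum, ← Finset.sum_add_distrib]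
    refine Finset.sum_congr rfl fun i _ => Finset.sum_congr rfl fun j _ => ?_
    simp only [Pi.zero_apply, ne_eq, OfNat.ofNat_ne_zero, not_false_eq_true, zero_pow,
      Finset.sum_const_zero, add_zero]
    rw [mul_add]
    simp only [Finset.mul_sum]
    congr 1
    · ring
    · exact Finset.sum_congr rfl fun k _ => Finset.sum_congr rfl fun l _ => by ring
  simp only [Pi.zero_apply] at ha ia iQ eQ
  simp_rw [integral_stdKernel_sq hM]
  rw [integral_add (ha.add (.sum hb)).integrable
      (HasAllMoments.sum fun i => .sum (hQ i)).integrable,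
    integral_add ha.integrable (HasAllMoments.sum hb).integrable,
    integral_finsetSum _ fun i _ => (hb i).integrable,
    integral_finsetSum _ fun i _ => (HasAllMoments.sum (hQ i)).integrable]
  simp_rw [integral_finsetSum _ fun j _ => (hQ _ j).integrable, integral_const_mul, stdKernelQuad,
    integral_sq_linear, ia, iQ, eQ, ea, eb]
  simp
  ring

end DoubleIntegral

lemma exists_posDef_factor {d : ℕ} {S : Matrix (Fin d) (Fin d) ℝ} (hS : S.PosDef) :
    ∃ A : Matrix (Fin d) (Fin d) ℝ, A.det ≠ 0 ∧ S = A * Aᵀ := by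
  open scoped MatrixOrder in
  obtain ⟨B, hB⟩ := CStarAlgebra.nonneg_iff_eq_star_mul_self.1 hS.posSemidef.nonneg
  have h : S = Bᵀ * Bᵀᵀ := by
    rw [hB, Matrix.star_eq_conjTranspose, conjTranspose_eq_transpose_of_trivial,
      transpose_transpose]
  refine ⟨Bᵀ, fun h0 => hS.det_pos.ne' ?_, h⟩
  rw [h, det_mul, h0, zero_mul]

lemma T4_add_mulVec {d : ℕ} (σ : ℝ) (m₀ : Fin d → ℝ) {A S W : Matrix (Fin d) (Fin d) ℝ}
    (hS : S = A * Aᵀ) (hW : (2 : ℝ) • Vm σ S - 1 = W) (z w : Fin d → ℝ) :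
    T4 σ m₀ S (m₀ + A *ᵥ z) (m₀ + A *ᵥ w) =
      W.det ^ (-(1 : ℝ) / 2) * stdKernel σ (Aᵀ * W⁻¹ * A) z w := by
  have hB (u : Fin d → ℝ) : Bm m₀ S (m₀ + A *ᵥ u) = A * hermiteTwo u * Aᵀ := by
    rw [Bm, add_sub_cancel_left, hermiteTwo, Matrix.mul_sub, Matrix.sub_mul, Matrix.mul_one, ← hS,
      Matrix.mul_vecMulVec, Matrix.vecMulVec_mul, Matrix.vecMul_transpose]
  have hH (u : Fin d → ℝ) : (A * hermiteTwo u * Aᵀ * W⁻¹).trace =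
      (hermiteTwo u * (Aᵀ * W⁻¹ * A)).trace := by
    rw [Matrix.mul_assoc, Matrix.mul_assoc, Matrix.trace_mul_comm]
    simp only [Matrix.mul_assoc]
  have hHH : (A * hermiteTwo z * Aᵀ * W⁻¹ * (A * hermiteTwo w * Aᵀ) * W⁻¹).trace =
      (hermiteTwo z * (Aᵀ * W⁻¹ * A) * hermiteTwo w * (Aᵀ * W⁻¹ * A)).trace := by
    simp only [Matrix.mul_assoc]
    rw [Matrix.trace_mul_comm]
    simp only [Matrix.mul_assoc]
  have hL : (vecMulVec (A *ᵥ z) (A *ᵥ w) * W⁻¹).trace = z ⬝ᵥ ((Aᵀ * W⁻¹ * A) *ᵥ w) := by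
    have hWt : (W⁻¹)ᵀ = W⁻¹ := by
      rw [transpose_nonsing_inv, ← hW, Vm, hS]
      simp [transpose_mul]
    rw [Matrix.vecMulVec_mul, Matrix.trace_vecMulVec, ← Matrix.mulVec_transpose, hWt,
      ← Matrix.mulVec_mulVec, ← Matrix.mulVec_mulVec, Matrix.dotProduct_mulVec z,
      Matrix.vecMul_transpose]
  simp only [T4, hW, hB, add_sub_cancel_left, Matrix.sub_mul, Matrix.trace_sub, Matrix.smul_mul,
    Matrix.trace_smul, hH, hHH, hL, stdKernel, smul_eq_mul]

/-- Explicit formula for `∫∫ T₄(x,y)² dN(m₀,Σ₀)(x) dN(m₀,Σ₀)(y)`. -/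
theorem T4_square_double_integral {d : ℕ} (hd : 1 ≤ d) (σ : ℝ) (hσ : 0 < σ)
    (m₀ : Fin d → ℝ) (S : Matrix (Fin d) (Fin d) ℝ) (hS : S.PosDef) :
    ∫ y, (∫ x, (T4 σ m₀ S x y) ^ 2 ∂(gaussN m₀ S)) ∂(gaussN m₀ S) =
      (Vm σ S + (2 * σ) • S).det⁻¹ *
        (1 + 8 * σ ^ 2 * (((Vm σ S + (2 * σ) • S)⁻¹ * S) ^ 2).trace
           + 12 * σ ^ 4 * (((Vm σ S + (2 * σ) • S)⁻¹ * S) ^ 2).trace ^ 2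
           + 24 * σ ^ 4 * (((Vm σ S + (2 * σ) • S)⁻¹ * S) ^ 4).trace) := by
  obtain ⟨A, hA, rfl⟩ := exists_posDef_factor hS
  set S := A * Aᵀ with hSA
  set W := Vm σ S + (2 * σ) • S with hW
  have hW1 : W = 1 + (4 * σ) • S := by
    rw [hW, Vm, add_assoc, ← add_smul]
    ring_nf
  have hW2 : (2 : ℝ) • Vm σ S - 1 = W := by
    rw [hW1, Vm, smul_add, smul_smul, two_smul]
    rw [show 2 * (2 * σ) = 4 * σ by ring]
    abel
  have hpos : 0 < W.det := by
    rw [hW1]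
    exact (Matrix.PosDef.one.add (hS.smul (by positivity))).det_pos
  set M := Aᵀ * W⁻¹ * A with hMdef
  have hM : Mᵀ = M := by
    have hWt : (W⁻¹)ᵀ = W⁻¹ := by
      rw [transpose_nonsing_inv, hW1, hSA]
      simp [transpose_mul]
    rw [hMdef, transpose_mul, transpose_mul, hWt, transpose_transpose, Matrix.mul_assoc]
  have htr2 : ((W⁻¹ * S) ^ 2).trace = (M ^ 2).trace := by
    simp only [sq, hSA, hMdef, ← Matrix.mul_assoc]
    rw [Matrix.trace_mul_comm]
    simp only [Matrix.mul_assoc]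
  have htr4 : ((W⁻¹ * S) ^ 4).trace = (M ^ 4).trace := by
    simp only [pow_succ, pow_zero, one_mul, hSA, hMdef, ← Matrix.mul_assoc]
    rw [Matrix.trace_mul_comm]
    simp only [Matrix.mul_assoc]
  have hc : (W.det ^ (-(1 : ℝ) / 2)) ^ 2 = W.det⁻¹ := by
    rw [← Real.rpow_natCast, ← Real.rpow_mul hpos.le]
    norm_num [Real.rpow_neg_one]
  have h := integral_integral_stdKernel_sq hM σ
  have hI (f : (Fin d → ℝ) → ℝ) :
      ∫ x, f x ∂(gaussN m₀ S) = ∫ z, f (m₀ + A *ᵥ z) ∂(stdGauss (Fin d)) :=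
    integral_gaussN f m₀ hA
  simp_rw [hI, T4_add_mulVec σ m₀ hSA hW2, mul_pow, integral_const_mul, hc]
  rw [h, htr2, htr4]
end

section
/- (Reduction of the variance formula, Lemmas 7–8.) Writing ∬ g for ∫_{ℝ^d}∫_{ℝ^d} g(x,y) dN(m₀,Σ₀)(x) dN(m₀,Σ₀)(y), one has ∬ K² = ∬ T₁² − 2 ∬ T₂² + ∬ T₄². -/
open MeasureTheory Matrix Real

lemma pi_gaussianReal_eq_withDensity (d : ℕ) :
    Measure.pi (fun _ : Fin d => ProbabilityTheory.gaussianReal 0 1) =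
      (volume : Measure (Fin d → ℝ)).withDensity fun w =>
        ENNReal.ofReal ((2 * π) ^ (-(d : ℝ) / 2) * Real.exp (-(w ⬝ᵥ w) / 2)) := by
  have hp : ∀ w : Fin d → ℝ, (2 * π) ^ (-(d : ℝ) / 2) * Real.exp (-(w ⬝ᵥ w) / 2) =
      ∏ i, ProbabilityTheory.gaussianPDFReal 0 1 (w i) := by
    intro w
    simp only [ProbabilityTheory.gaussianPDFReal, Finset.prod_mul_distrib, ← Real.exp_sum,
      Finset.prod_const, Finset.card_univ, Fintype.card_fin, NNReal.coe_one, mul_one, sub_zero]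
    congr 1
    · rw [Real.sqrt_eq_rpow, ← Real.rpow_neg (by positivity), ← Real.rpow_natCast,
        ← Real.rpow_mul (by positivity)]
      congr 1; ring
    · rw [← Finset.sum_div, Finset.sum_neg_distrib]
      simp [dotProduct, sq]
  apply Measure.pi_eq
  intro s hs
  simp only [hp]
  rw [withDensity_apply _ (MeasurableSet.univ_pi hs), volume_pi, Measure.restrict_pi_pi,
    ← ofReal_integral_eq_lintegral_ofReal, integral_fintype_prod_eq_prod
      (f := fun _ x => ProbabilityTheory.gaussianPDFReal 0 1 x),
    ENNReal.ofReal_prod_of_nonneg]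
  · refine Finset.prod_congr rfl fun i _ => ?_
    rw [ProbabilityTheory.gaussianReal_apply_eq_integral _ one_ne_zero]
  · exact fun i _ => integral_nonneg fun x => ProbabilityTheory.gaussianPDFReal_nonneg _ _ _
  · exact Integrable.fintype_prod fun i =>
      (ProbabilityTheory.integrable_gaussianPDFReal 0 1).integrableOn
  · exact Filter.Eventually.of_forall fun x =>
      Finset.prod_nonneg fun i _ => ProbabilityTheory.gaussianPDFReal_nonneg _ _ _

lemma Matrix.PosDef.exists_eq_mul_transpose {d : ℕ} {S : Matrix (Fin d) (Fin d) ℝ}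
    (hS : S.PosDef) : ∃ L : Matrix (Fin d) (Fin d) ℝ, S = L * Lᵀ ∧ L.det ≠ 0 := by
  obtain ⟨B, hB⟩ : ∃ B : Matrix (Fin d) (Fin d) ℝ, S = Bᴴ * B := by
    open scoped MatrixOrder in
    exact CStarAlgebra.nonneg_iff_eq_star_mul_self.mp hS.posSemidef.nonneg
  refine ⟨Bᵀ, by simpa [conjTranspose] using hB, fun h => ?_⟩
  have := hS.det_pos
  rw [hB, det_mul] at this
  simp_all

lemma gaussN_eq_map {d : ℕ} (m : Fin d → ℝ) {S L : Matrix (Fin d) (Fin d) ℝ}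
    (hL : S = L * Lᵀ) (hdet : L.det ≠ 0) :
    gaussN m S = (Measure.pi fun _ : Fin d => ProbabilityTheory.gaussianReal 0 1).map
      (fun w => L *ᵥ w + m) := by
  have hdens : ∀ w : Fin d → ℝ, (2 * π) ^ (-(d : ℝ) / 2) * Real.exp (-(w ⬝ᵥ w) / 2) =
      |L.det| * ((2 * π) ^ (-(d : ℝ) / 2) * S.det ^ (-(1 : ℝ) / 2) *
      Real.exp (-(((L *ᵥ w + m) - m) ⬝ᵥ (S⁻¹ *ᵥ ((L *ᵥ w + m) - m))) / 2)) := by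
    intro w
    have h1 : |L.det| * S.det ^ (-(1 : ℝ) / 2) = 1 := by
      rw [hL, det_mul, det_transpose, ← sq, ← sq_abs, ← Real.rpow_natCast,
        ← Real.rpow_mul (abs_nonneg _)]
      norm_num
      rw [Real.rpow_neg_one, mul_inv_cancel₀ (abs_ne_zero.2 hdet)]
    have h2 : (L *ᵥ w) ⬝ᵥ (S⁻¹ *ᵥ (L *ᵥ w)) = w ⬝ᵥ w := by
      have hu : IsUnit L.det := isUnit_iff_ne_zero.2 hdet
      have hu' : IsUnit Lᵀ.det := by simpa using hu
      rw [mulVec_mulVec, hL, Matrix.mul_inv_rev, Matrix.mul_assoc, nonsing_inv_mul _ hu,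
        Matrix.mul_one, dotProduct_comm, ← dotProduct_transpose_mulVec, mulVec_mulVec,
        mul_nonsing_inv _ hu', one_mulVec]
    rw [add_sub_cancel_right, h2]
    linear_combination (-(2 * π) ^ (-(d : ℝ) / 2) * Real.exp (-(w ⬝ᵥ w) / 2)) * h1
  rw [pi_gaussianReal_eq_withDensity]
  ext s hs
  have hmeas : Measurable fun w : Fin d → ℝ => L *ᵥ w + m := by fun_prop
  rw [Measure.map_apply hmeas hs, gaussN, withDensity_apply _ hs, withDensity_apply _ (hmeas hs)]
  have hvol : Measure.map (fun w : Fin d → ℝ => L *ᵥ w + m) volume =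
      ENNReal.ofReal |(L.det)⁻¹| • volume := by
    have hcomp : (fun w : Fin d → ℝ => L *ᵥ w + m) = (fun x => x + m) ∘ toLin' L := by
      ext w; simp
    rw [hcomp, ← Measure.map_map (by fun_prop) (by fun_prop),
      Real.map_matrix_volume_pi_eq_smul_volume_pi hdet, Measure.map_smul,
      MeasureTheory.map_add_right_eq_self]
  have hcont : Measurable fun x : Fin d → ℝ => ENNReal.ofReal ((2 * π) ^ (-(d : ℝ) / 2) *
      S.det ^ (-(1 : ℝ) / 2) * Real.exp (-((x - m) ⬝ᵥ (S⁻¹ *ᵥ (x - m))) / 2)) := by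
    fun_prop
  simp only [hdens, ENNReal.ofReal_mul (abs_nonneg L.det)]
  refine Eq.trans ?_ (lintegral_const_mul _ (hcont.comp hmeas)).symm
  refine Eq.trans ?_ (congrArg (ENNReal.ofReal |L.det| * ·) (setLIntegral_map hs hcont hmeas))
  rw [hvol, Measure.restrict_smul, lintegral_smul_measure, smul_eq_mul, ← mul_assoc,
    ← ENNReal.ofReal_mul (abs_nonneg _), ← abs_mul, mul_inv_cancel₀ hdet]
  simp

lemma gaussN_map_dotProduct {d : ℕ} (m : Fin d → ℝ) {S : Matrix (Fin d) (Fin d) ℝ}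
    (hS : S.PosDef) (a : Fin d → ℝ) :
    (gaussN m S).map (fun x => a ⬝ᵥ (x - m)) =
      ProbabilityTheory.gaussianReal 0 (a ⬝ᵥ S *ᵥ a).toNNReal := by
  obtain ⟨L, hL, hdet⟩ := hS.exists_eq_mul_transpose
  set l : StrongDual ℝ (EuclideanSpace ℝ (Fin d)) := innerSL ℝ (WithLp.toLp 2 (Lᵀ *ᵥ a))
  have hcomp : (fun x => a ⬝ᵥ (x - m)) ∘ (fun w : Fin d → ℝ => L *ᵥ w + m) =
      l ∘ WithLp.toLp 2 := by
    ext w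
    simp only [Function.comp_apply, add_sub_cancel_right, l, innerSL_apply_apply]
    rw [EuclideanSpace.inner_eq_star_dotProduct]
    simp [dotProduct_mulVec, dotProduct_comm, mulVec_transpose]
  rw [gaussN_eq_map m hL hdet, Measure.map_map (by fun_prop) (by fun_prop), hcomp,
    ← Measure.map_map (by fun_prop) (by fun_prop), ProbabilityTheory.map_pi_eq_stdGaussian,
    ProbabilityTheory.IsGaussian.map_eq_gaussianReal,
    ProbabilityTheory.integral_strongDual_stdGaussian,
    ProbabilityTheory.variance_dual_stdGaussian]
  congr 2
  rw [innerSL_apply_norm, EuclideanSpace.real_norm_sq_eq, hL, ← mulVec_mulVec]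
  rw [dotProduct_mulVec, ← mulVec_transpose]
  simp [dotProduct, sq]

lemma isGaussian_gaussN {d : ℕ} (m : Fin d → ℝ) {S : Matrix (Fin d) (Fin d) ℝ}
    (hS : S.PosDef) : ProbabilityTheory.IsGaussian (gaussN m S) := by
  refine ProbabilityTheory.isGaussian_of_map_eq_gaussianReal fun l => ?_
  set a : Fin d → ℝ := fun i => l (Pi.single i 1)
  have hl : ∀ x, l x = a ⬝ᵥ x := fun x => by
    conv_lhs => rw [← Finset.univ_sum_single x, map_sum]
    refine Finset.sum_congr rfl fun i _ => ?_
    have h : Pi.single i (x i) = x i • (Pi.single i 1 : Fin d → ℝ) := by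
      rw [← Pi.single_smul, smul_eq_mul, mul_one]
    rw [h, map_smul, smul_eq_mul, mul_comm]
  refine ⟨0 + a ⬝ᵥ m, (a ⬝ᵥ S *ᵥ a).toNNReal, ?_⟩
  have hcomp : (l : (Fin d → ℝ) → ℝ) = (fun t => t + a ⬝ᵥ m) ∘ fun x => a ⬝ᵥ (x - m) := by
    ext x; simp [hl, dotProduct_sub]
  rw [hcomp, ← Measure.map_map (by fun_prop) (by fun_prop), gaussN_map_dotProduct m hS,
    ProbabilityTheory.gaussianReal_map_add_const]

lemma integral_sq_gaussianReal_zero (v : NNReal) :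
    ∫ x, x ^ 2 ∂(ProbabilityTheory.gaussianReal 0 v) = v := by
  have := ProbabilityTheory.variance_fun_id_gaussianReal (μ := 0) (v := v)
  rw [ProbabilityTheory.variance_of_integral_eq_zero (by fun_prop) (by simp)] at this
  simpa using this

lemma integral_pow_four_gaussianReal_zero (v : NNReal) :
    ∫ x, x ^ 4 ∂(ProbabilityTheory.gaussianReal 0 v) = 3 * (v : ℝ) ^ 2 := by
  have h := ProbabilityTheory.iteratedDeriv_mgf_zero (X := fun x : ℝ => x)
    (μ := ProbabilityTheory.gaussianReal 0 v) (by simp) 4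
  simp only [Pi.pow_apply] at h
  rw [← h, ProbabilityTheory.mgf_fun_id_gaussianReal]
  have key : ∀ (p q : ℝ → ℝ), (∀ t, HasDerivAt p (q t - v * t * p t) t) →
      deriv (fun t => p t * Real.exp (0 * t + v * t ^ 2 / 2)) =
        fun t => q t * Real.exp (0 * t + v * t ^ 2 / 2) := by
    intro p q hp
    ext t
    have he : HasDerivAt (fun t : ℝ => Real.exp (0 * t + v * t ^ 2 / 2))
        (Real.exp (0 * t + v * t ^ 2 / 2) * (v * t)) t := by
      refine HasDerivAt.exp ?_
      have := (((hasDerivAt_id t).const_mul 0).add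
        ((((hasDerivAt_id t).pow 2).const_mul (v : ℝ)).div_const 2))
      refine this.congr_deriv ?_
      simp; ring
    refine (((hp t).mul he).congr_deriv ?_).deriv
    ring
  have key' : ∀ (p q : ℝ → ℝ), (∀ t, HasDerivAt p (q t - v * t * p t) t) → ∀ n,
      iteratedDeriv (n + 1) (fun t => p t * Real.exp (0 * t + v * t ^ 2 / 2)) =
        iteratedDeriv n fun t => q t * Real.exp (0 * t + v * t ^ 2 / 2) := by
    intro p q hp n
    rw [iteratedDeriv_succ', key p q hp]
  have h0 : (fun t : ℝ => Real.exp (0 * t + v * t ^ 2 / 2)) =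
      fun t => 1 * Real.exp (0 * t + v * t ^ 2 / 2) := by simp
  rw [h0, key' (fun _ => 1) (fun t => v * t), key' (fun t => v * t) (fun t => v + v ^ 2 * t ^ 2),
    key' (fun t => v + v ^ 2 * t ^ 2) (fun t => 3 * v ^ 2 * t + v ^ 3 * t ^ 3),
    key' (fun t => 3 * v ^ 2 * t + v ^ 3 * t ^ 3)
      (fun t => 3 * v ^ 2 + 6 * v ^ 3 * t ^ 2 + v ^ 4 * t ^ 4)]
  · simp
  · intro t
    have := (((hasDerivAt_id t).const_mul (3 * (v : ℝ) ^ 2)).add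
      (((hasDerivAt_id t).pow 3).const_mul ((v : ℝ) ^ 3)))
    refine this.congr_deriv ?_
    simp; ring
  · intro t
    have := (((hasDerivAt_id t).pow 2).const_mul ((v : ℝ) ^ 2)).const_add (v : ℝ)
    refine this.congr_deriv ?_
    simp; ring
  · intro t
    refine ((hasDerivAt_id t).const_mul (v : ℝ)).congr_deriv ?_
    simp; ring
  · intro t
    refine (hasDerivAt_const t (1 : ℝ)).congr_deriv ?_
    ring

/-- A continuous function bounded by a power of `1 + ‖x‖`. -/
def HasPolyGrowth {E : Type*} [NormedAddCommGroup E] (f : E → ℝ) : Prop :=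
  Continuous f ∧ ∃ (C : ℝ) (k : ℕ), ∀ x, |f x| ≤ C * (1 + ‖x‖) ^ k

namespace HasPolyGrowth

variable {E : Type*} [NormedAddCommGroup E] {f g : E → ℝ}

lemma of_bounded (hf : Continuous f) {C : ℝ} (h : ∀ x, |f x| ≤ C) : HasPolyGrowth f :=
  ⟨hf, C, 0, by simpa using h⟩

lemma const (c : ℝ) : HasPolyGrowth fun _ : E => c :=
  of_bounded continuous_const fun _ => le_rfl

lemma add (hf : HasPolyGrowth f) (hg : HasPolyGrowth g) : HasPolyGrowth fun x => f x + g x := by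
  obtain ⟨hf, C, k, h⟩ := hf
  obtain ⟨hg, D, l, h'⟩ := hg
  refine ⟨hf.add hg, |C| + |D|, k + l, fun x => ?_⟩
  have h1 : (1 : ℝ) ≤ 1 + ‖x‖ := by simp
  have hk : (1 + ‖x‖) ^ k ≤ (1 + ‖x‖) ^ (k + l) := pow_le_pow_right₀ h1 (by simp)
  have hl : (1 + ‖x‖) ^ l ≤ (1 + ‖x‖) ^ (k + l) := pow_le_pow_right₀ h1 (by simp)
  calc |f x + g x| ≤ |f x| + |g x| := abs_add_le _ _
    _ ≤ C * (1 + ‖x‖) ^ k + D * (1 + ‖x‖) ^ l := add_le_add (h x) (h' x)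
    _ ≤ |C| * (1 + ‖x‖) ^ (k + l) + |D| * (1 + ‖x‖) ^ (k + l) := by
        gcongr
        · exact le_abs_self _
        · exact le_abs_self _
    _ = _ := by ring

lemma mul (hf : HasPolyGrowth f) (hg : HasPolyGrowth g) : HasPolyGrowth fun x => f x * g x := by
  obtain ⟨hf, C, k, h⟩ := hf
  obtain ⟨hg, D, l, h'⟩ := hg
  refine ⟨hf.mul hg, C * D, k + l, fun x => ?_⟩
  rw [abs_mul, pow_add]
  calc |f x| * |g x| ≤ (C * (1 + ‖x‖) ^ k) * (D * (1 + ‖x‖) ^ l) :=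
        mul_le_mul (h x) (h' x) (abs_nonneg _) ((abs_nonneg _).trans (h x))
    _ = _ := by ring

lemma sub (hf : HasPolyGrowth f) (hg : HasPolyGrowth g) : HasPolyGrowth fun x => f x - g x := by
  simpa [sub_eq_add_neg] using hf.add ((const (-1)).mul hg)

lemma pow (hf : HasPolyGrowth f) (n : ℕ) : HasPolyGrowth fun x => f x ^ n := by
  induction n with
  | zero => simpa using const 1
  | succ n ih => simpa [pow_succ] using ih.mul hf

lemma sum {ι : Type*} {F : ι → E → ℝ} (s : Finset ι) (h : ∀ i, HasPolyGrowth (F i)) :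
    HasPolyGrowth fun x => ∑ i ∈ s, F i x := by
  classical
  induction s using Finset.induction_on with
  | empty => simpa using const 0
  | insert i s hi ih => simpa [Finset.sum_insert hi] using (h i).add ih

lemma of_continuousLinearMap [NormedSpace ℝ E] (l : E →L[ℝ] ℝ) : HasPolyGrowth fun x => l x := by
  refine ⟨l.continuous, ‖l‖, 1, fun x => ?_⟩
  rw [pow_one]
  refine (l.le_opNorm x).trans ?_
  gcongr
  simp

lemma integrable [NormedSpace ℝ E] [CompleteSpace E] [SecondCountableTopology E]
    [MeasurableSpace E] [BorelSpace E] (hf : HasPolyGrowth f) (μ : Measure E)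
    [ProbabilityTheory.IsGaussian μ] : Integrable f μ := by
  obtain ⟨hf, C, k, h⟩ := hf
  have h0 : MemLp (fun x : E => ‖x‖) k μ :=
    (ProbabilityTheory.IsGaussian.memLp_id μ k (ENNReal.natCast_ne_top k)).norm
  have h1 : MemLp (fun x : E => 1 + ‖x‖) k μ := (memLp_const (1 : ℝ)).add h0
  have h2 : Integrable (fun x : E => C * (1 + ‖x‖) ^ k) μ := by
    refine (h1.integrable_norm_pow'.const_mul C).congr (Filter.Eventually.of_forall fun x => ?_)
    beta_reduce
    rw [Real.norm_of_nonneg (by positivity)]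
  exact h2.mono' hf.aestronglyMeasurable (Filter.Eventually.of_forall h)

lemma comp_sub_fst {d : ℕ} (m : Fin d → ℝ) (i : Fin d) :
    HasPolyGrowth fun p : (Fin d → ℝ) × (Fin d → ℝ) => (p.1 - m) i :=
  (of_continuousLinearMap ((ContinuousLinearMap.proj i).comp
    (ContinuousLinearMap.fst ℝ (Fin d → ℝ) (Fin d → ℝ)))).sub (const (m i))

lemma comp_sub_snd {d : ℕ} (m : Fin d → ℝ) (i : Fin d) :
    HasPolyGrowth fun p : (Fin d → ℝ) × (Fin d → ℝ) => (p.2 - m) i :=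
  (of_continuousLinearMap ((ContinuousLinearMap.proj i).comp
    (ContinuousLinearMap.snd ℝ (Fin d → ℝ) (Fin d → ℝ)))).sub (const (m i))

lemma apply_sub {d : ℕ} (m : Fin d → ℝ) (i : Fin d) :
    HasPolyGrowth fun x : Fin d → ℝ => (x - m) i :=
  (of_continuousLinearMap (ContinuousLinearMap.proj (R := ℝ) (φ := fun _ : Fin d => ℝ) i)).sub
    (const (m i))

lemma dotProduct {d : ℕ} {u v : E → Fin d → ℝ} (hu : ∀ i, HasPolyGrowth fun x => u x i)
    (hv : ∀ i, HasPolyGrowth fun x => v x i) : HasPolyGrowth fun x => u x ⬝ᵥ v x :=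
  sum _ fun i => (hu i).mul (hv i)

lemma mulVec {d : ℕ} (A : Matrix (Fin d) (Fin d) ℝ) {u : E → Fin d → ℝ}
    (hu : ∀ i, HasPolyGrowth fun x => u x i) (i : Fin d) : HasPolyGrowth fun x => (A *ᵥ u x) i :=
  dotProduct (u := fun _ => A i) (fun j => const (A i j)) hu

end HasPolyGrowth

section Moments

variable {d : ℕ} (m : Fin d → ℝ) {S : Matrix (Fin d) (Fin d) ℝ}

lemma integral_dotProduct_sq_gaussN (hS : S.PosDef) (a : Fin d → ℝ) :
    ∫ x, (a ⬝ᵥ (x - m)) ^ 2 ∂(gaussN m S) = a ⬝ᵥ S *ᵥ a := by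
  have h := integral_map (μ := gaussN m S) (φ := fun x => a ⬝ᵥ (x - m))
    (f := fun t => t ^ 2) (by fun_prop) (by fun_prop)
  rw [gaussN_map_dotProduct m hS, integral_sq_gaussianReal_zero] at h
  rw [← h, Real.coe_toNNReal _ (by simpa using hS.posSemidef.dotProduct_mulVec_nonneg a)]

lemma integral_dotProduct_pow_four_gaussN (hS : S.PosDef) (a : Fin d → ℝ) :
    ∫ x, (a ⬝ᵥ (x - m)) ^ 4 ∂(gaussN m S) = 3 * (a ⬝ᵥ S *ᵥ a) ^ 2 := by
  have h := integral_map (μ := gaussN m S) (φ := fun x => a ⬝ᵥ (x - m))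
    (f := fun t => t ^ 4) (by fun_prop) (by fun_prop)
  rw [gaussN_map_dotProduct m hS, integral_pow_four_gaussianReal_zero] at h
  rw [← h, Real.coe_toNNReal _ (by simpa using hS.posSemidef.dotProduct_mulVec_nonneg a)]

lemma hasPolyGrowth_dotProduct_sub (a : Fin d → ℝ) :
    HasPolyGrowth fun x : Fin d → ℝ => a ⬝ᵥ (x - m) :=
  .dotProduct (fun i => .const (a i)) (.apply_sub m)

lemma Matrix.IsSymm.dotProduct_mulVec_comm (hS : S.IsSymm) (a b : Fin d → ℝ) :
    a ⬝ᵥ S *ᵥ b = b ⬝ᵥ S *ᵥ a := by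
  rw [dotProduct_mulVec, ← mulVec_transpose, hS, dotProduct_comm]

lemma Matrix.PosDef.isSymm (hS : S.PosDef) : S.IsSymm := by
  have h := hS.isHermitian
  rwa [IsHermitian, conjTranspose_eq_transpose_of_trivial] at h

lemma integral_dotProduct_mul_gaussN (hS : S.PosDef) (a b : Fin d → ℝ) :
    ∫ x, (a ⬝ᵥ (x - m)) * (b ⬝ᵥ (x - m)) ∂(gaussN m S) = a ⬝ᵥ S *ᵥ b := by
  have := isGaussian_gaussN m hS
  have h (x : Fin d → ℝ) : (a ⬝ᵥ (x - m)) * (b ⬝ᵥ (x - m)) =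
      1 / 4 * (((a + b) ⬝ᵥ (x - m)) ^ 2 - ((a - b) ⬝ᵥ (x - m)) ^ 2) := by
    rw [add_dotProduct, sub_dotProduct]; ring
  simp only [h]
  rw [integral_const_mul, integral_sub
    (((hasPolyGrowth_dotProduct_sub m _).pow 2).integrable _)
    (((hasPolyGrowth_dotProduct_sub m _).pow 2).integrable _),
    integral_dotProduct_sq_gaussN m hS, integral_dotProduct_sq_gaussN m hS]
  simp only [add_dotProduct, sub_dotProduct, mulVec_add, mulVec_sub, dotProduct_add,
    dotProduct_sub, hS.isSymm.dotProduct_mulVec_comm b a]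
  ring

/-- Isserlis' formula for fourth moments. -/
lemma integral_dotProduct_mul_four_gaussN (hS : S.PosDef) (a b c e : Fin d → ℝ) :
    ∫ x, (a ⬝ᵥ (x - m)) * (b ⬝ᵥ (x - m)) * ((c ⬝ᵥ (x - m)) * (e ⬝ᵥ (x - m))) ∂(gaussN m S) =
      (a ⬝ᵥ S *ᵥ b) * (c ⬝ᵥ S *ᵥ e) + (a ⬝ᵥ S *ᵥ c) * (b ⬝ᵥ S *ᵥ e) +
        (a ⬝ᵥ S *ᵥ e) * (b ⬝ᵥ S *ᵥ c) := by
  have := isGaussian_gaussN m hS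
  let v : Fin 8 → Fin d → ℝ := ![a + b + c + e, a + b - c - e, a - b + c - e, a - b - c + e,
    a + b + c - e, a + b - c + e, a - b + c + e, a - b - c - e]
  let w : Fin 8 → ℝ := ![1, 1, 1, 1, -1, -1, -1, -1]
  have h (x : Fin d → ℝ) :
      (a ⬝ᵥ (x - m)) * (b ⬝ᵥ (x - m)) * ((c ⬝ᵥ (x - m)) * (e ⬝ᵥ (x - m))) =
      ∑ i, w i / 192 * (v i ⬝ᵥ (x - m)) ^ 4 := by
    simp only [Fin.sum_univ_eight, v, w, Matrix.cons_val, add_dotProduct, sub_dotProduct]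
    ring
  simp only [h]
  rw [integral_finsetSum _ fun i _ =>
    (((hasPolyGrowth_dotProduct_sub m (v i)).pow 4).integrable _).const_mul (w i / 192)]
  simp only [integral_const_mul, integral_dotProduct_pow_four_gaussN m hS]
  simp only [Fin.sum_univ_eight, v, w, Matrix.cons_val, add_dotProduct, sub_dotProduct,
    mulVec_add, mulVec_sub, dotProduct_add, dotProduct_sub, hS.isSymm.dotProduct_mulVec_comm b a,
    hS.isSymm.dotProduct_mulVec_comm c a, hS.isSymm.dotProduct_mulVec_comm e a,
    hS.isSymm.dotProduct_mulVec_comm c b, hS.isSymm.dotProduct_mulVec_comm e b,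
    hS.isSymm.dotProduct_mulVec_comm e c]
  ring

lemma integral_gaussN_s6 (f : (Fin d → ℝ) → ℝ) (hS : S.PosDef) :
    ∫ x, f x ∂(gaussN m S) = ∫ x, (2 * π) ^ (-(d : ℝ) / 2) * S.det ^ (-(1 : ℝ) / 2) *
      Real.exp (-((x - m) ⬝ᵥ (S⁻¹ *ᵥ (x - m))) / 2) * f x := by
  have := hS.det_pos
  rw [gaussN, integral_withDensity_eq_integral_toReal_smul (by fun_prop) (by simp)]
  refine integral_congr_ae (Filter.Eventually.of_forall fun x => ?_)
  beta_reduce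
  rw [ENNReal.toReal_ofReal (by positivity), smul_eq_mul]

lemma integral_odd_gaussN (hS : S.PosDef) (f : (Fin d → ℝ) → ℝ) (hf : ∀ z, f (-z) = -f z) :
    ∫ x, f (x - m) ∂(gaussN m S) = 0 := by
  rw [integral_gaussN_s6 m _ hS]
  have h := integral_sub_left_eq_self (μ := (volume : Measure (Fin d → ℝ))) (fun x =>
    (2 * π) ^ (-(d : ℝ) / 2) * S.det ^ (-(1 : ℝ) / 2) *
      Real.exp (-((x - m) ⬝ᵥ (S⁻¹ *ᵥ (x - m))) / 2) * f (x - m)) (m + m)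
  have h2 (x : Fin d → ℝ) : m + m - x - m = -(x - m) := by abel
  simp only [h2, hf, mulVec_neg, neg_dotProduct_neg, mul_neg, integral_neg] at h
  linarith

end Moments

/-- The quadratic polynomial `z ↦ c + bᵀz + zᵀRz`. -/
def quadPoly {d : ℕ} (c : ℝ) (b : Fin d → ℝ) (R : Matrix (Fin d) (Fin d) ℝ) (z : Fin d → ℝ) : ℝ :=
  c + b ⬝ᵥ z + z ⬝ᵥ R *ᵥ z

section QuadPoly

variable {d : ℕ} (m : Fin d → ℝ) {S : Matrix (Fin d) (Fin d) ℝ}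

lemma hasPolyGrowth_dotProduct_mulVec_sub (R : Matrix (Fin d) (Fin d) ℝ) :
    HasPolyGrowth fun x : Fin d → ℝ => (x - m) ⬝ᵥ R *ᵥ (x - m) :=
  .dotProduct (.apply_sub m) (.mulVec R (.apply_sub m))

lemma dotProduct_mulVec_eq_sum (R : Matrix (Fin d) (Fin d) ℝ) (z : Fin d → ℝ) :
    z ⬝ᵥ R *ᵥ z = ∑ p : Fin d × Fin d, R p.1 p.2 * (z p.1 * z p.2) := by
  rw [Fintype.sum_prod_type]
  simp only [dotProduct, mulVec, Finset.mul_sum]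
  exact Finset.sum_congr rfl fun i _ => Finset.sum_congr rfl fun j _ => by ring

lemma trace_mul_eq_sum_s6 (R : Matrix (Fin d) (Fin d) ℝ) (hS : S.IsSymm) :
    (R * S).trace = ∑ p : Fin d × Fin d, R p.1 p.2 * S p.1 p.2 := by
  rw [Fintype.sum_prod_type]
  simp only [trace, diag_apply, mul_apply]
  exact Finset.sum_congr rfl fun i _ => Finset.sum_congr rfl fun j _ => by rw [hS.apply]

lemma integral_dotProduct_mulVec_gaussN (hS : S.PosDef) (R : Matrix (Fin d) (Fin d) ℝ) :
    ∫ x, (x - m) ⬝ᵥ R *ᵥ (x - m) ∂(gaussN m S) = (R * S).trace := by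
  have := isGaussian_gaussN m hS
  simp only [dotProduct_mulVec_eq_sum]
  rw [integral_finsetSum _ fun p _ => ((HasPolyGrowth.const (R p.1 p.2)).mul
    ((HasPolyGrowth.apply_sub m p.1).mul (.apply_sub m p.2))).integrable _,
    trace_mul_eq_sum_s6 R hS.isSymm]
  refine Finset.sum_congr rfl fun p _ => ?_
  rw [integral_const_mul]
  congr 1
  simpa using integral_dotProduct_mul_gaussN m hS (Pi.single p.1 1) (Pi.single p.2 1)

lemma integral_dotProduct_mulVec_mul_gaussN (hS : S.PosDef) {R : Matrix (Fin d) (Fin d) ℝ}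
    (hR : R.IsSymm) (R' : Matrix (Fin d) (Fin d) ℝ) :
    ∫ x, ((x - m) ⬝ᵥ R *ᵥ (x - m)) * ((x - m) ⬝ᵥ R' *ᵥ (x - m)) ∂(gaussN m S) =
      (R * S).trace * (R' * S).trace + 2 * (S * R * S * R').trace := by
  have := isGaussian_gaussN m hS
  simp only [dotProduct_mulVec_eq_sum, Finset.sum_mul_sum]
  have hg (p q : Fin d × Fin d) : HasPolyGrowth fun x : Fin d → ℝ =>
      R p.1 p.2 * ((x - m) p.1 * (x - m) p.2) * (R' q.1 q.2 * ((x - m) q.1 * (x - m) q.2)) :=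
    ((HasPolyGrowth.const (R p.1 p.2)).mul ((HasPolyGrowth.apply_sub m p.1).mul
      (.apply_sub m p.2))).mul ((HasPolyGrowth.const (R' q.1 q.2)).mul
      ((HasPolyGrowth.apply_sub m q.1).mul (.apply_sub m q.2)))
  rw [integral_finsetSum _ fun p _ => (HasPolyGrowth.sum _ fun q => hg p q).integrable _]
  have hterm (p q : Fin d × Fin d) : ∫ x, R p.1 p.2 * ((x - m) p.1 * (x - m) p.2) *
      (R' q.1 q.2 * ((x - m) q.1 * (x - m) q.2)) ∂(gaussN m S) =
      (R p.1 p.2 * S p.1 p.2) * (R' q.1 q.2 * S q.1 q.2) +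
        (R p.2 p.1 * R' q.1 q.2 * (S p.1 q.1 * S p.2 q.2) +
          R p.1 p.2 * R' q.1 q.2 * (S p.1 q.2 * S p.2 q.1)) := by
    have h := integral_dotProduct_mul_four_gaussN m hS (Pi.single p.1 1) (Pi.single p.2 1)
      (Pi.single q.1 1) (Pi.single q.2 1)
    simp only [single_one_dotProduct, mulVec_single_one, col_apply] at h
    have h2 (x : Fin d → ℝ) : R p.1 p.2 * ((x - m) p.1 * (x - m) p.2) *
      (R' q.1 q.2 * ((x - m) q.1 * (x - m) q.2)) = R p.1 p.2 * R' q.1 q.2 *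
        ((x - m) p.1 * (x - m) p.2 * ((x - m) q.1 * (x - m) q.2)) := by ring
    simp only [h2, integral_const_mul, h, hR.apply p.1 p.2]
    ring
  have htr : (S * R * S * R').trace = ∑ p : Fin d × Fin d, ∑ q : Fin d × Fin d,
      R p.1 p.2 * R' q.1 q.2 * (S p.1 q.2 * S p.2 q.1) := by
    have h1 : S * R * S * R' = S * (R * (S * R')) := by simp only [Matrix.mul_assoc]
    rw [h1, trace_mul_comm]
    simp only [Fintype.sum_prod_type, trace, diag_apply, mul_apply, Finset.sum_mul, Finset.mul_sum]
    refine Finset.sum_congr rfl fun i _ => ?_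
    rw [Finset.sum_comm' (t' := Finset.univ) (s' := fun _ => Finset.univ) (by simp)]
    refine Finset.sum_congr rfl fun j _ => ?_
    rw [Finset.sum_comm]
    refine Finset.sum_congr rfl fun k _ => Finset.sum_congr rfl fun l _ => ?_
    rw [hS.isSymm.apply i l]
    ring
  have htr' : (S * R * S * R').trace = ∑ p : Fin d × Fin d, ∑ q : Fin d × Fin d,
      R p.2 p.1 * R' q.1 q.2 * (S p.1 q.1 * S p.2 q.2) := by
    rw [htr, ← (Equiv.prodComm (Fin d) (Fin d)).sum_comp]
    refine Finset.sum_congr rfl fun p _ => Finset.sum_congr rfl fun q _ => ?_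
    simp only [Equiv.prodComm_apply, Prod.fst_swap, Prod.snd_swap]
    ring
  rw [two_mul]
  nth_rw 1 [htr']
  rw [htr, trace_mul_eq_sum_s6 R hS.isSymm, trace_mul_eq_sum_s6 R' hS.isSymm, Finset.sum_mul_sum]
  simp only [← Finset.sum_add_distrib]
  refine Finset.sum_congr rfl fun p _ => ?_
  rw [integral_finsetSum _ fun q _ => (hg p q).integrable _]
  exact Finset.sum_congr rfl fun q _ => hterm p q

lemma hasPolyGrowth_quadPoly (c : ℝ) (b : Fin d → ℝ) (R : Matrix (Fin d) (Fin d) ℝ) :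
    HasPolyGrowth fun x : Fin d → ℝ => quadPoly c b R (x - m) :=
  ((HasPolyGrowth.const c).add (hasPolyGrowth_dotProduct_sub m b)).add
    (hasPolyGrowth_dotProduct_mulVec_sub m R)

lemma integral_quadPoly_gaussN (hS : S.PosDef) (c : ℝ) (b : Fin d → ℝ)
    (R : Matrix (Fin d) (Fin d) ℝ) :
    ∫ x, quadPoly c b R (x - m) ∂(gaussN m S) = c + (R * S).trace := by
  have := isGaussian_gaussN m hS
  have hb := hasPolyGrowth_dotProduct_sub m b
  have hR := hasPolyGrowth_dotProduct_mulVec_sub m R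
  simp only [quadPoly]
  rw [integral_add (((HasPolyGrowth.const c).add hb).integrable _) (hR.integrable _),
    integral_add (integrable_const c) (hb.integrable _),
    integral_dotProduct_mulVec_gaussN m hS, integral_odd_gaussN m hS (fun z => b ⬝ᵥ z) (by simp)]
  simp

lemma integral_quadPoly_mul_quadPoly_gaussN (hS : S.PosDef) (c c' : ℝ) (b b' : Fin d → ℝ)
    {R : Matrix (Fin d) (Fin d) ℝ} (hR : R.IsSymm) (R' : Matrix (Fin d) (Fin d) ℝ) :
    ∫ x, quadPoly c b R (x - m) * quadPoly c' b' R' (x - m) ∂(gaussN m S) =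
      (c + (R * S).trace) * c' + (S *ᵥ b) ⬝ᵥ b' +
        (((c + (R * S).trace) • S + (2 : ℝ) • (S * R * S)) * R').trace := by
  have := isGaussian_gaussN m hS
  have e (z : Fin d → ℝ) : quadPoly c b R z * quadPoly c' b' R' z =
      quadPoly (c * c') 0 (c • R' + c' • R) z + (b ⬝ᵥ z) * (b' ⬝ᵥ z) +
        (z ⬝ᵥ R *ᵥ z) * (z ⬝ᵥ R' *ᵥ z) +
        (c * (b' ⬝ᵥ z) + c' * (b ⬝ᵥ z) + (b ⬝ᵥ z) * (z ⬝ᵥ R' *ᵥ z) +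
          (z ⬝ᵥ R *ᵥ z) * (b' ⬝ᵥ z)) := by
    simp only [quadPoly, add_mulVec, smul_mulVec, dotProduct_add, dotProduct_smul, smul_eq_mul,
      zero_dotProduct]
    ring
  have h1 := hasPolyGrowth_quadPoly m (c * c') 0 (c • R' + c' • R)
  have h2 := (hasPolyGrowth_dotProduct_sub m b).mul (hasPolyGrowth_dotProduct_sub m b')
  have h3 := (hasPolyGrowth_dotProduct_mulVec_sub m R).mul
    (hasPolyGrowth_dotProduct_mulVec_sub m R')
  have h4 := ((((HasPolyGrowth.const c).mul (hasPolyGrowth_dotProduct_sub m b')).add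
    ((HasPolyGrowth.const c').mul (hasPolyGrowth_dotProduct_sub m b))).add
    ((hasPolyGrowth_dotProduct_sub m b).mul (hasPolyGrowth_dotProduct_mulVec_sub m R'))).add
    ((hasPolyGrowth_dotProduct_mulVec_sub m R).mul (hasPolyGrowth_dotProduct_sub m b'))
  simp only [e]
  rw [integral_add (((h1.add h2).add h3).integrable _) (h4.integrable _),
    integral_add ((h1.add h2).integrable _) (h3.integrable _),
    integral_add (h1.integrable _) (h2.integrable _),
    integral_quadPoly_gaussN m hS, integral_dotProduct_mul_gaussN m hS,
    integral_dotProduct_mulVec_mul_gaussN m hS hR,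
    integral_odd_gaussN m hS (fun z => c * (b' ⬝ᵥ z) + c' * (b ⬝ᵥ z) +
      (b ⬝ᵥ z) * (z ⬝ᵥ R' *ᵥ z) + (z ⬝ᵥ R *ᵥ z) * (b' ⬝ᵥ z))
      (fun z => by simp only [dotProduct_neg, neg_dotProduct, mulVec_neg]; ring),
    hS.isSymm.dotProduct_mulVec_comm b b', dotProduct_comm (S *ᵥ b)]
  simp only [Matrix.add_mul, Matrix.smul_mul, trace_add, trace_smul, smul_eq_mul,
    trace_mul_comm S R']
  ring

end QuadPoly

section Tilting

variable {d : ℕ} (m : Fin d → ℝ) {S C P : Matrix (Fin d) (Fin d) ℝ}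

lemma integral_exp_mul_gaussN (hS : S.PosDef) (hC : C.PosDef) (hP : C⁻¹ = S⁻¹ + (2 : ℝ) • P)
    {D : ℝ} (hD : 0 < D) (hdet : S.det = D * C.det) (h : Fin d → ℝ) (f : (Fin d → ℝ) → ℝ) :
    ∫ x, Real.exp (h ⬝ᵥ (x - m) - (x - m) ⬝ᵥ P *ᵥ (x - m)) * f x ∂(gaussN m S) =
      D ^ (-(1 : ℝ) / 2) * Real.exp (h ⬝ᵥ C *ᵥ h / 2) * ∫ x, f x ∂(gaussN (m + C *ᵥ h) C) := by
  rw [integral_gaussN_s6 m _ hS, integral_gaussN_s6 (m + C *ᵥ h) _ hC, ← integral_const_mul]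
  refine integral_congr_ae (Filter.Eventually.of_forall fun x => ?_)
  beta_reduce
  rw [← sub_sub]
  generalize x - m = z
  have hCh : C⁻¹ *ᵥ (C *ᵥ h) = h := by
    rw [mulVec_mulVec, nonsing_inv_mul _ hC.det_pos.ne'.isUnit, one_mulVec]
  have hq : -(z ⬝ᵥ (S⁻¹ *ᵥ z)) / 2 + (h ⬝ᵥ z - z ⬝ᵥ P *ᵥ z) =
      h ⬝ᵥ C *ᵥ h / 2 + -((z - C *ᵥ h) ⬝ᵥ (C⁻¹ *ᵥ (z - C *ᵥ h))) / 2 := by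
    have h1 : (C *ᵥ h) ⬝ᵥ C⁻¹ *ᵥ z = h ⬝ᵥ z := by
      rw [hC.inv.isSymm.dotProduct_mulVec_comm, hCh, dotProduct_comm]
    have h2 : z ⬝ᵥ C⁻¹ *ᵥ z = z ⬝ᵥ S⁻¹ *ᵥ z + 2 * z ⬝ᵥ P *ᵥ z := by
      rw [hP, add_mulVec, smul_mulVec, dotProduct_add, dotProduct_smul, smul_eq_mul]
    rw [mulVec_sub C⁻¹, hCh, sub_dotProduct, dotProduct_sub, dotProduct_sub, h1, h2,
      dotProduct_comm z h, dotProduct_comm (C *ᵥ h) h]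
    ring
  rw [hdet, Real.mul_rpow hD.le hC.det_pos.le]
  have he := congrArg Real.exp hq
  rw [Real.exp_add, Real.exp_add] at he
  linear_combination ((2 * π) ^ (-(d : ℝ) / 2) * D ^ (-(1 : ℝ) / 2) *
    C.det ^ (-(1 : ℝ) / 2) * f x) * he

end Tilting

section VmMatrix

variable {d : ℕ} {σ : ℝ} {S : Matrix (Fin d) (Fin d) ℝ}

lemma two_smul_Vm_sub_one : (2 : ℝ) • Vm σ S - 1 = Vm (2 * σ) S := by
  rw [Vm, Vm, smul_add, smul_smul, two_smul ℝ (1 : Matrix (Fin d) (Fin d) ℝ)]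
  abel

lemma posDef_Vm (hσ : 0 < σ) (hS : S.PosDef) : (Vm σ S).PosDef :=
  PosDef.one.add (hS.smul (by positivity))

lemma Vm_mul_inv (hσ : 0 < σ) (hS : S.PosDef) : Vm σ S * (Vm σ S)⁻¹ = 1 :=
  mul_nonsing_inv _ (posDef_Vm hσ hS).det_pos.ne'.isUnit

lemma inv_mul_Vm (hσ : 0 < σ) (hS : S.PosDef) : (Vm σ S)⁻¹ * Vm σ S = 1 :=
  nonsing_inv_mul _ (posDef_Vm hσ hS).det_pos.ne'.isUnit

lemma inv_Vm_add (hσ : 0 < σ) (hS : S.PosDef) :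
    (Vm σ S)⁻¹ + (2 * σ) • (S * (Vm σ S)⁻¹) = 1 := by
  rw [← Vm_mul_inv hσ hS]
  conv_rhs => rw [Vm]
  rw [Matrix.add_mul, Matrix.one_mul, Matrix.smul_mul]; rfl

lemma mul_inv_Vm_comm (hσ : 0 < σ) (hS : S.PosDef) :
    S * (Vm σ S)⁻¹ = (Vm σ S)⁻¹ * S := by
  have h : S * Vm σ S = Vm σ S * S := by
    simp [Vm, Matrix.mul_add, Matrix.add_mul]
  calc S * (Vm σ S)⁻¹ = ((Vm σ S)⁻¹ * Vm σ S) * S * (Vm σ S)⁻¹ := by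
        rw [inv_mul_Vm hσ hS, Matrix.one_mul]
    _ = (Vm σ S)⁻¹ * S * (Vm σ S * (Vm σ S)⁻¹) := by
        rw [Matrix.mul_assoc (Vm σ S)⁻¹, ← h]; simp only [Matrix.mul_assoc]
    _ = _ := by rw [Vm_mul_inv hσ hS, Matrix.mul_one]

/-- `S V⁻¹` is the covariance of the Gaussian `N(m, S)` tilted by `exp(-σ‖x-y‖²)`. -/
lemma mul_inv_Vm_eq_sub (hσ : 0 < σ) (hS : S.PosDef) :
    S * (Vm σ S)⁻¹ = S - (2 * σ) • (S * (Vm σ S)⁻¹ * S) := by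
  rw [eq_sub_iff_add_eq, Matrix.mul_assoc, ← mul_inv_Vm_comm hσ hS, ← Matrix.mul_smul,
    ← Matrix.mul_add, inv_Vm_add hσ hS, Matrix.mul_one]

lemma inv_mul_inv_Vm (hσ : 0 < σ) (hS : S.PosDef) :
    (S * (Vm σ S)⁻¹)⁻¹ = S⁻¹ + (2 : ℝ) • (σ • (1 : Matrix (Fin d) (Fin d) ℝ)) := by
  rw [Matrix.mul_inv_rev, nonsing_inv_nonsing_inv _ (posDef_Vm hσ hS).det_pos.ne'.isUnit, Vm,
    Matrix.add_mul, Matrix.one_mul, Matrix.smul_mul,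
    mul_nonsing_inv _ hS.det_pos.ne'.isUnit, smul_smul]

lemma det_mul_inv_Vm (hσ : 0 < σ) (hS : S.PosDef) :
    S.det = (Vm σ S).det * (S * (Vm σ S)⁻¹).det := by
  rw [det_mul, mul_left_comm, ← det_mul, Vm_mul_inv hσ hS, det_one, mul_one]

lemma posDef_mul_inv_Vm (hσ : 0 < σ) (hS : S.PosDef) : (S * (Vm σ S)⁻¹).PosDef := by
  refine posDef_inv_iff.mp ?_
  rw [inv_mul_inv_Vm hσ hS]
  exact hS.inv.add ((PosDef.one.smul hσ).smul two_pos)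

lemma Vm_two_mul : Vm (2 * σ) S = Vm σ S + (2 * σ) • S := by
  simp only [Vm]
  rw [add_assoc, ← add_smul]
  ring_nf

lemma inv_Vm_sub_inv_Vm (hσ : 0 < σ) (hS : S.PosDef) :
    (2 * σ) • ((Vm (2 * σ) S)⁻¹ * S * (Vm σ S)⁻¹) = (Vm σ S)⁻¹ - (Vm (2 * σ) S)⁻¹ := by
  have h : (2 * σ) • S = Vm (2 * σ) S - Vm σ S := by rw [Vm_two_mul]; abel
  rw [← Matrix.smul_mul, ← Matrix.mul_smul, h, Matrix.mul_sub, Matrix.sub_mul,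
    inv_mul_Vm (by positivity) hS, Matrix.one_mul, Matrix.mul_assoc, Vm_mul_inv hσ hS,
    Matrix.mul_one]

/-- The covariance of the Gaussian `N(m, S)` tilted by `exp(-σ(x-m)ᵀV⁻¹(x-m))`. -/
lemma mul_Vm_mul_inv_eq_sub (hσ : 0 < σ) (hS : S.PosDef) :
    S * Vm σ S * (Vm (2 * σ) S)⁻¹ = S - (2 * σ) • (S * (Vm (2 * σ) S)⁻¹ * S) := by
  have h : Vm σ S = Vm (2 * σ) S - (2 * σ) • S := by rw [Vm_two_mul]; abel
  rw [Matrix.mul_assoc, h, Matrix.sub_mul, Vm_mul_inv (by positivity) hS, Matrix.smul_mul,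
    Matrix.mul_sub, Matrix.mul_one, Matrix.mul_smul, Matrix.mul_assoc S _ S,
    ← mul_inv_Vm_comm (by positivity) hS]

lemma inv_mul_Vm_mul_inv (hσ : 0 < σ) (hS : S.PosDef) :
    (S * Vm σ S * (Vm (2 * σ) S)⁻¹)⁻¹ = S⁻¹ + (2 : ℝ) • (σ • (Vm σ S)⁻¹) := by
  rw [Matrix.mul_inv_rev, Matrix.mul_inv_rev, nonsing_inv_nonsing_inv _
    (posDef_Vm (by positivity) hS).det_pos.ne'.isUnit, Vm_two_mul, Matrix.add_mul,
    ← Matrix.mul_assoc, Vm_mul_inv hσ hS, Matrix.one_mul, Matrix.smul_mul, ← Matrix.mul_assoc,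
    mul_inv_Vm_comm hσ hS, Matrix.mul_assoc, mul_nonsing_inv _ hS.det_pos.ne'.isUnit,
    Matrix.mul_one, smul_smul]

lemma posDef_mul_Vm_mul_inv (hσ : 0 < σ) (hS : S.PosDef) :
    (S * Vm σ S * (Vm (2 * σ) S)⁻¹).PosDef := by
  refine posDef_inv_iff.mp ?_
  rw [inv_mul_Vm_mul_inv hσ hS]
  exact hS.inv.add (((posDef_Vm hσ hS).inv.smul hσ).smul two_pos)

lemma det_mul_Vm_mul_inv (hσ : 0 < σ) (hS : S.PosDef) :
    S.det = (Vm (2 * σ) S).det / (Vm σ S).det * (S * Vm σ S * (Vm (2 * σ) S)⁻¹).det := by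
  have h := congrArg Matrix.det (Vm_mul_inv (σ := 2 * σ) (by positivity) hS)
  have h' := (posDef_Vm hσ hS).det_pos.ne'
  rw [det_mul, det_one] at h
  rw [det_mul, det_mul]
  field_simp
  linear_combination (-S.det) * h

lemma mul_Vm_mul_inv_mul_inv (hσ : 0 < σ) (hS : S.PosDef) :
    S * Vm σ S * (Vm (2 * σ) S)⁻¹ * (Vm σ S)⁻¹ = S * (Vm (2 * σ) S)⁻¹ := by
  rw [mul_Vm_mul_inv_eq_sub hσ hS, Matrix.sub_mul, Matrix.smul_mul, Matrix.mul_assoc S,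
    Matrix.mul_assoc S, ← Matrix.mul_smul, inv_Vm_sub_inv_Vm hσ hS, Matrix.mul_sub]
  abel

end VmMatrix

section Kernels

variable {d : ℕ} {σ : ℝ} (m : Fin d → ℝ) {S : Matrix (Fin d) (Fin d) ℝ}

lemma trace_mul_vecMulVec (M : Matrix (Fin d) (Fin d) ℝ) (u v : Fin d → ℝ) :
    (M * vecMulVec u v).trace = v ⬝ᵥ M *ᵥ u := by
  rw [mul_vecMulVec, trace_vecMulVec, dotProduct_comm]

lemma trace_mul_Bm (M : Matrix (Fin d) (Fin d) ℝ) (x : Fin d → ℝ) :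
    (M * Bm m S x).trace = (x - m) ⬝ᵥ M *ᵥ (x - m) - (M * S).trace := by
  rw [Bm, Matrix.mul_sub, trace_sub, trace_mul_vecMulVec]

lemma integral_quadPoly_gaussN_add (hS : S.PosDef) (p : Fin d → ℝ) (c : ℝ) (b : Fin d → ℝ)
    (R : Matrix (Fin d) (Fin d) ℝ) :
    ∫ x, quadPoly c b R (x - m) ∂(gaussN (m + p) S) =
      c + p ⬝ᵥ b + ((vecMulVec p p + S) * R).trace := by
  have h (x : Fin d → ℝ) : quadPoly c b R (x - m) =
      quadPoly (c + b ⬝ᵥ p + p ⬝ᵥ R *ᵥ p) (b + R *ᵥ p + Rᵀ *ᵥ p) R (x - (m + p)) := by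
    rw [← sub_sub]
    obtain ⟨z, hz⟩ : ∃ z, x - m = z + p := ⟨x - m - p, by abel⟩
    have e : p ⬝ᵥ R *ᵥ z = (Rᵀ *ᵥ p) ⬝ᵥ z := by rw [mulVec_transpose, dotProduct_mulVec]
    rw [hz, add_sub_cancel_right]
    simp only [quadPoly, mulVec_add, add_dotProduct, dotProduct_add, e,
      dotProduct_comm z (R *ᵥ p)]
    ring
  simp only [h]
  rw [integral_quadPoly_gaussN _ hS, Matrix.add_mul, trace_add, trace_mul_comm (vecMulVec p p),
    trace_mul_vecMulVec, trace_mul_comm S, dotProduct_comm p b]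
  ring

/-- As a function of its second argument, `T₂` is a quadratic polynomial. -/
lemma T2_eq_quadPoly_snd (hσ : 0 < σ) (hS : S.PosDef) (x y : Fin d → ℝ) :
    T2 σ m S x y = (Vm σ S).det ^ (-(1 : ℝ) / 2) *
      Real.exp (-σ * ((x - m) ⬝ᵥ ((Vm σ S)⁻¹ *ᵥ (x - m)))) *
      quadPoly (1 - (σ • ((Vm σ S)⁻¹ *
          ((2 * σ) • vecMulVec (x - m) (x - m) * (Vm σ S)⁻¹ - 1)) * S).trace)
        ((Vm σ S)⁻¹ *ᵥ ((2 * σ) • (x - m)))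
        (σ • ((Vm σ S)⁻¹ * ((2 * σ) • vecMulVec (x - m) (x - m) * (Vm σ S)⁻¹ - 1))) (y - m) := by
  have hB : Bm m S x + S = vecMulVec (x - m) (x - m) := by rw [Bm, sub_add_cancel]
  rw [T2, hB, trace_mul_Bm, quadPoly,
    (posDef_Vm hσ hS).inv.isSymm.dotProduct_mulVec_comm (x - m) (y - m),
    Matrix.smul_mul σ, trace_smul, smul_mulVec, mulVec_smul, smul_dotProduct, dotProduct_smul,
    dotProduct_comm (y - m) ((Vm σ S)⁻¹ *ᵥ (x - m))]
  simp only [smul_eq_mul]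
  ring

lemma isSymm_inv_Vm (hσ : 0 < σ) (hS : S.PosDef) : ((Vm σ S)⁻¹).IsSymm :=
  (posDef_Vm hσ hS).inv.isSymm

lemma integral_T1_mul_quadPoly (hσ : 0 < σ) (hS : S.PosDef) (x : Fin d → ℝ) (c : ℝ)
    (b : Fin d → ℝ) (R : Matrix (Fin d) (Fin d) ℝ) :
    ∫ y, T1 σ x y * quadPoly c b R (y - m) ∂(gaussN m S) =
      (Vm σ S).det ^ (-(1 : ℝ) / 2) *
        Real.exp (-σ * ((x - m) ⬝ᵥ ((Vm σ S)⁻¹ *ᵥ (x - m)))) *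
        (c + ((S * (Vm σ S)⁻¹) *ᵥ ((2 * σ) • (x - m))) ⬝ᵥ b +
          ((vecMulVec ((S * (Vm σ S)⁻¹) *ᵥ ((2 * σ) • (x - m)))
            ((S * (Vm σ S)⁻¹) *ᵥ ((2 * σ) • (x - m))) + S * (Vm σ S)⁻¹) * R).trace) := by
  have hT1 (y : Fin d → ℝ) : T1 σ x y = Real.exp (-σ * ((x - m) ⬝ᵥ (x - m))) *
      Real.exp (((2 * σ) • (x - m)) ⬝ᵥ (y - m) -
        (y - m) ⬝ᵥ (σ • (1 : Matrix (Fin d) (Fin d) ℝ)) *ᵥ (y - m)) := by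
    rw [T1, ← Real.exp_add, ← sub_sub_sub_cancel_right x y m]
    generalize x - m = u
    generalize y - m = w
    simp only [sub_dotProduct, dotProduct_sub, smul_mulVec, one_mulVec, dotProduct_smul,
      smul_dotProduct, smul_eq_mul, dotProduct_comm w u]
    congr 1
    ring
  have hexp : (2 * σ) • (S * (Vm σ S)⁻¹) = 1 - (Vm σ S)⁻¹ := by
    rw [← inv_Vm_add hσ hS]; abel
  simp only [hT1, mul_assoc]
  rw [integral_const_mul, integral_exp_mul_gaussN m hS (posDef_mul_inv_Vm hσ hS)
    (inv_mul_inv_Vm hσ hS) (posDef_Vm hσ hS).det_pos (det_mul_inv_Vm hσ hS),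
    integral_quadPoly_gaussN_add m (posDef_mul_inv_Vm hσ hS)]
  have he : ((2 * σ) • (x - m)) ⬝ᵥ (S * (Vm σ S)⁻¹) *ᵥ ((2 * σ) • (x - m)) / 2 =
      σ * ((x - m) ⬝ᵥ (x - m)) + -σ * ((x - m) ⬝ᵥ ((Vm σ S)⁻¹ *ᵥ (x - m))) := by
    rw [mulVec_smul, ← smul_mulVec, hexp, sub_mulVec, one_mulVec, smul_dotProduct,
      dotProduct_sub (_ - _ : Fin d → ℝ), smul_eq_mul]
    ring
  rw [he, Real.exp_add, neg_mul σ (_ ⬝ᵥ _), Real.exp_neg]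
  have := Real.exp_pos (σ * ((x - m) ⬝ᵥ (x - m)))
  field_simp

lemma integral_T1_mul_quadPoly_eq (hσ : 0 < σ) (hS : S.PosDef) (x : Fin d → ℝ) (c : ℝ)
    (b : Fin d → ℝ) (R : Matrix (Fin d) (Fin d) ℝ) :
    ∫ y, T1 σ x y * quadPoly c b R (y - m) ∂(gaussN m S) =
      ∫ y, T2 σ m S x y * quadPoly c b R (y - m) ∂(gaussN m S) := by
  rw [integral_T1_mul_quadPoly m hσ hS]
  simp only [T2_eq_quadPoly_snd m hσ hS, mul_assoc _ (quadPoly _ _ _ _)]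
  have hsymm := isSymm_inv_Vm hσ hS
  have hR : (σ • ((Vm σ S)⁻¹ *
      ((2 * σ) • vecMulVec (x - m) (x - m) * (Vm σ S)⁻¹ - 1))).IsSymm := by
    rw [IsSymm, transpose_smul, transpose_mul, transpose_sub, transpose_mul, transpose_smul,
      transpose_vecMulVec, hsymm, transpose_one, Matrix.mul_sub, Matrix.sub_mul, Matrix.mul_one,
      Matrix.one_mul, Matrix.mul_assoc]
  rw [integral_const_mul, integral_quadPoly_mul_quadPoly_gaussN m hS _ _ _ _ hR,
    sub_add_cancel, one_mul, one_smul, mulVec_mulVec]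
  congr 4
  have hp : vecMulVec ((S * (Vm σ S)⁻¹) *ᵥ ((2 * σ) • (x - m)))
      ((S * (Vm σ S)⁻¹) *ᵥ ((2 * σ) • (x - m))) = (2 * σ) ^ 2 •
      (S * (Vm σ S)⁻¹ * vecMulVec (x - m) (x - m) * ((Vm σ S)⁻¹ * S)) := by
    rw [mulVec_smul, vecMulVec_smul, smul_vecMulVec, smul_smul, ← sq, mul_vecMulVec, vecMulVec_mul,
      ← mulVec_transpose, transpose_mul, hsymm, hS.isSymm]
  rw [hp]
  conv_lhs => enter [2]; rw [mul_inv_Vm_eq_sub hσ hS]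
  simp only [Matrix.mul_sub, Matrix.sub_mul, Matrix.mul_smul, Matrix.smul_mul, Matrix.mul_assoc,
    Matrix.mul_one, smul_sub, smul_smul]
  module

/-- As a function of its first argument, `T₂` is a Gaussian times a quadratic polynomial. -/
lemma T2_eq_exp_mul_quadPoly_fst (x y : Fin d → ℝ) :
    T2 σ m S x y = (Vm σ S).det ^ (-(1 : ℝ) / 2) *
      (Real.exp ((0 : Fin d → ℝ) ⬝ᵥ (x - m) - (x - m) ⬝ᵥ (σ • (Vm σ S)⁻¹) *ᵥ (x - m)) *
      quadPoly (1 - σ * ((Vm σ S)⁻¹ * Bm m S y).trace) ((Vm σ S)⁻¹ *ᵥ ((2 * σ) • (y - m)))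
        ((2 * σ ^ 2) • ((Vm σ S)⁻¹ * Bm m S y * (Vm σ S)⁻¹)) (x - m)) := by
  have hB : Bm m S x + S = vecMulVec (x - m) (x - m) := by rw [Bm, sub_add_cancel]
  have ht : ((Vm σ S)⁻¹ * ((2 * σ) • vecMulVec (x - m) (x - m) * (Vm σ S)⁻¹ - 1) *
      Bm m S y).trace = 2 * σ * ((x - m) ⬝ᵥ ((Vm σ S)⁻¹ * Bm m S y * (Vm σ S)⁻¹) *ᵥ (x - m)) -
        ((Vm σ S)⁻¹ * Bm m S y).trace := by
    rw [Matrix.mul_sub, Matrix.mul_one, Matrix.sub_mul, trace_sub, Matrix.smul_mul,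
      Matrix.mul_smul, Matrix.smul_mul, trace_smul, smul_eq_mul, ← trace_mul_vecMulVec,
      Matrix.mul_assoc _ (Vm σ S)⁻¹, trace_mul_comm ((Vm σ S)⁻¹ * Bm m S y)]
    congr 3
    simp only [← Matrix.mul_assoc]
  rw [T2, hB, ht, quadPoly, dotProduct_comm (_ *ᵥ _) (x - m), zero_dotProduct, zero_sub]
  simp only [smul_mulVec, mulVec_smul, dotProduct_smul, smul_eq_mul, neg_mul]
  ring

/-- As a function of its first argument, `T₄` is a quadratic polynomial. -/
lemma T4_eq_quadPoly_fst (hσ : 0 < σ) (hS : S.PosDef) (x y : Fin d → ℝ) :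
    T4 σ m S x y = (Vm (2 * σ) S).det ^ (-(1 : ℝ) / 2) *
      quadPoly (1 - σ * ((Vm (2 * σ) S)⁻¹ * Bm m S y).trace -
          (((-σ + σ ^ 2 * ((Vm (2 * σ) S)⁻¹ * Bm m S y).trace) • (Vm (2 * σ) S)⁻¹ +
            (2 * σ ^ 2) • ((Vm (2 * σ) S)⁻¹ * Bm m S y * (Vm (2 * σ) S)⁻¹)) * S).trace)
        ((Vm (2 * σ) S)⁻¹ *ᵥ ((2 * σ) • (y - m)))
        ((-σ + σ ^ 2 * ((Vm (2 * σ) S)⁻¹ * Bm m S y).trace) • (Vm (2 * σ) S)⁻¹ +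
          (2 * σ ^ 2) • ((Vm (2 * σ) S)⁻¹ * Bm m S y * (Vm (2 * σ) S)⁻¹)) (x - m) := by
  rw [T4, two_smul_Vm_sub_one]
  have hX := isSymm_inv_Vm (σ := 2 * σ) (by positivity) hS
  generalize (Vm (2 * σ) S)⁻¹ = X at hX ⊢
  have h1 : (Bm m S x * X * Bm m S y * X).trace =
      (x - m) ⬝ᵥ (X * Bm m S y * X) *ᵥ (x - m) - (X * Bm m S y * X * S).trace := by
    rw [← trace_mul_Bm, trace_mul_comm (X * Bm m S y * X)]
    simp only [Matrix.mul_assoc]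
  rw [h1, Matrix.sub_mul, Matrix.sub_mul, trace_sub, trace_sub, Matrix.smul_mul, trace_smul,
    trace_mul_comm (vecMulVec _ _), trace_mul_comm (Bm m S x), trace_mul_comm (Bm m S y),
    trace_mul_vecMulVec, trace_mul_Bm m X x, quadPoly, hX.dotProduct_mulVec_comm (y - m),
    dotProduct_comm _ (x - m)]
  simp only [add_mulVec, smul_mulVec, mulVec_smul, dotProduct_add, dotProduct_smul, smul_eq_mul,
    Matrix.add_mul, Matrix.smul_mul, trace_add, trace_smul]
  ring

lemma isSymm_Bm (hS : S.IsSymm) (x : Fin d → ℝ) : (Bm m S x).IsSymm := by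
  rw [IsSymm, Bm, transpose_sub, transpose_vecMulVec, hS]

lemma integral_T2_mul_quadPoly_eq (hσ : 0 < σ) (hS : S.PosDef) (y : Fin d → ℝ) (c : ℝ)
    (b : Fin d → ℝ) (R : Matrix (Fin d) (Fin d) ℝ) :
    ∫ x, T2 σ m S x y * quadPoly c b R (x - m) ∂(gaussN m S) =
      ∫ x, T4 σ m S x y * quadPoly c b R (x - m) ∂(gaussN m S) := by
  have hσ' : 0 < 2 * σ := by positivity
  have hC := posDef_mul_Vm_mul_inv hσ hS
  have hV := (posDef_Vm hσ hS).det_pos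
  have hW := (posDef_Vm hσ' hS).det_pos
  have hB := isSymm_Bm m hS.isSymm y
  have hA := isSymm_inv_Vm hσ hS
  have hX := isSymm_inv_Vm hσ' hS
  have hsymm {M : Matrix (Fin d) (Fin d) ℝ} (hM : M.IsSymm) : (M * Bm m S y * M).IsSymm := by
    rw [IsSymm, transpose_mul, transpose_mul, hB, hM, Matrix.mul_assoc]
  simp only [T2_eq_exp_mul_quadPoly_fst m, T4_eq_quadPoly_fst m hσ hS, mul_assoc (_ ^ _),
    mul_assoc (Real.exp _)]
  rw [integral_const_mul, integral_const_mul, integral_exp_mul_gaussN m hS hC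
    (inv_mul_Vm_mul_inv hσ hS) (div_pos hW hV) (det_mul_Vm_mul_inv hσ hS), mulVec_zero,
    add_zero, dotProduct_zero, zero_div, Real.exp_zero, mul_one, ← mul_assoc,
    ← Real.mul_rpow hV.le (div_pos hW hV).le, mul_div_cancel₀ _ hV.ne',
    integral_quadPoly_mul_quadPoly_gaussN m hC _ _ _ _ ((hsymm hA).smul _),
    integral_quadPoly_mul_quadPoly_gaussN m hS _ _ _ _
      ((hX.smul _).add ((hsymm hX).smul _)), sub_add_cancel]
  have hCA := mul_Vm_mul_inv_mul_inv hσ hS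
  have hAC := congrArg transpose hCA
  rw [transpose_mul (_ * _ * _), transpose_mul S, hC.isSymm, hA, hX, hS.isSymm] at hAC
  have hAX := inv_Vm_sub_inv_Vm hσ hS
  have hCeq := mul_Vm_mul_inv_eq_sub hσ hS
  set A := (Vm σ S)⁻¹
  set X := (Vm (2 * σ) S)⁻¹
  set C := S * Vm σ S * X
  set B := Bm m S y
  have htr : 1 - σ * (A * B).trace + ((2 * σ ^ 2) • (A * B * A) * C).trace =
      1 - σ * (X * B).trace := by
    have h : (A * B * A * C).trace = (X * S * A * B).trace := by
      rw [Matrix.mul_assoc (A * B), hAC, trace_mul_comm, ← Matrix.mul_assoc]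
    have h2 := congrArg (fun M => (M * B).trace) hAX
    simp only [Matrix.smul_mul, trace_smul, Matrix.sub_mul, trace_sub, smul_eq_mul] at h2
    rw [Matrix.smul_mul, trace_smul, h, smul_eq_mul]
    linear_combination σ * h2
  rw [htr, mulVec_mulVec, mulVec_mulVec, hCA]
  congr 4
  have hCRC : C * ((2 * σ ^ 2) • (A * B * A)) * C = (2 * σ ^ 2) • (S * X * B * (X * S)) := by
    rw [← hCA, ← hAC]
    simp only [Matrix.mul_smul, Matrix.smul_mul, Matrix.mul_assoc]
  rw [hCRC, hCeq]
  simp only [Matrix.mul_add, Matrix.add_mul, Matrix.mul_smul, Matrix.smul_mul, Matrix.mul_assoc]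
  module

lemma T1_comm (x y : Fin d → ℝ) : T1 σ x y = T1 σ y x := by
  rw [T1, T1, ← neg_sub y x, neg_dotProduct_neg]

lemma T4_comm (hσ : 0 < σ) (hS : S.PosDef) (x y : Fin d → ℝ) : T4 σ m S x y = T4 σ m S y x := by
  simp only [T4, two_smul_Vm_sub_one, Matrix.sub_mul, trace_sub, Matrix.smul_mul, trace_smul]
  have hX := isSymm_inv_Vm (σ := 2 * σ) (by positivity) hS
  generalize (Vm (2 * σ) S)⁻¹ = X at hX ⊢
  rw [trace_mul_comm (vecMulVec (x - m) _), trace_mul_comm (vecMulVec (y - m) _),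
    trace_mul_vecMulVec, trace_mul_vecMulVec, hX.dotProduct_mulVec_comm (y - m),
    Matrix.mul_assoc (Bm m S x * X), trace_mul_comm (Bm m S x * X), ← Matrix.mul_assoc]
  ring

namespace HasPolyGrowth

variable {E : Type*} [NormedAddCommGroup E] {M N : E → Matrix (Fin d) (Fin d) ℝ}

lemma matrix_const (A : Matrix (Fin d) (Fin d) ℝ) (i j : Fin d) :
    HasPolyGrowth fun _ : E => A i j := .const _

lemma matrix_mul (hM : ∀ i j, HasPolyGrowth fun z => M z i j)
    (hN : ∀ i j, HasPolyGrowth fun z => N z i j) (i j : Fin d) :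
    HasPolyGrowth fun z => (M z * N z) i j := by
  simp only [mul_apply]
  exact .sum _ fun k => (hM i k).mul (hN k j)

lemma matrix_trace (hM : ∀ i j, HasPolyGrowth fun z => M z i j) :
    HasPolyGrowth fun z => (M z).trace :=
  .sum _ fun i => hM i i

lemma vecMulVec {u v : E → Fin d → ℝ} (hu : ∀ i, HasPolyGrowth fun z => u z i)
    (hv : ∀ i, HasPolyGrowth fun z => v z i) (i j : Fin d) :
    HasPolyGrowth fun z => Matrix.vecMulVec (u z) (v z) i j :=
  (hu i).mul (hv j)

end HasPolyGrowth

lemma hasPolyGrowth_T1 (hσ : 0 < σ) :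
    HasPolyGrowth fun z : (Fin d → ℝ) × (Fin d → ℝ) => T1 σ z.1 z.2 := by
  refine .of_bounded (C := 1) (by unfold T1; fun_prop) fun z => ?_
  rw [T1, Real.abs_exp, Real.exp_le_one_iff]
  have h : 0 ≤ (z.1 - z.2) ⬝ᵥ (z.1 - z.2) := by
    simpa using dotProduct_star_self_nonneg (z.1 - z.2)
  nlinarith

lemma hasPolyGrowth_T2 (hσ : 0 < σ) (hS : S.PosDef) :
    HasPolyGrowth fun z : (Fin d → ℝ) × (Fin d → ℝ) => T2 σ m S z.1 z.2 := by
  have hexp : HasPolyGrowth fun z : (Fin d → ℝ) × (Fin d → ℝ) =>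
      Real.exp (-σ * ((z.1 - m) ⬝ᵥ ((Vm σ S)⁻¹ *ᵥ (z.1 - m)))) := by
    refine .of_bounded (C := 1) (by fun_prop) fun z => ?_
    rw [Real.abs_exp, Real.exp_le_one_iff]
    have h : 0 ≤ (z.1 - m) ⬝ᵥ ((Vm σ S)⁻¹ *ᵥ (z.1 - m)) := by
      simpa using (posDef_Vm hσ hS).inv.posSemidef.dotProduct_mulVec_nonneg (z.1 - m)
    nlinarith
  have hB (i j) : HasPolyGrowth fun z : (Fin d → ℝ) × (Fin d → ℝ) => Bm m S z.2 i j :=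
    (HasPolyGrowth.vecMulVec (.comp_sub_snd m) (.comp_sub_snd m) i j).sub (.const (S i j))
  have hu (i j) : HasPolyGrowth fun z : (Fin d → ℝ) × (Fin d → ℝ) =>
      ((2 * σ) • (Bm m S z.1 + S)) i j :=
    (HasPolyGrowth.const (2 * σ)).mul (((HasPolyGrowth.vecMulVec (.comp_sub_fst m)
      (.comp_sub_fst m) i j).sub (.const (S i j))).add (.const (S i j)))
  exact ((HasPolyGrowth.const _).mul hexp).mul (((HasPolyGrowth.const 1).add
    ((HasPolyGrowth.const (2 * σ)).mul (.dotProduct (.comp_sub_fst m)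
      (.mulVec _ (.comp_sub_snd m))))).add ((HasPolyGrowth.const σ).mul
    (.matrix_trace (.matrix_mul (.matrix_mul (.matrix_const _) fun i j =>
      (HasPolyGrowth.matrix_mul hu (.matrix_const _) i j).sub (.matrix_const 1 i j)) hB))))

lemma hasPolyGrowth_T4 :
    HasPolyGrowth fun z : (Fin d → ℝ) × (Fin d → ℝ) => T4 σ m S z.1 z.2 := by
  have hB1 (i j) : HasPolyGrowth fun z : (Fin d → ℝ) × (Fin d → ℝ) => Bm m S z.1 i j :=
    (HasPolyGrowth.vecMulVec (.comp_sub_fst m) (.comp_sub_fst m) i j).sub (.const (S i j))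
  have hB2 (i j) : HasPolyGrowth fun z : (Fin d → ℝ) × (Fin d → ℝ) => Bm m S z.2 i j :=
    (HasPolyGrowth.vecMulVec (.comp_sub_snd m) (.comp_sub_snd m) i j).sub (.const (S i j))
  have huw (i j) : HasPolyGrowth fun z : (Fin d → ℝ) × (Fin d → ℝ) =>
      ((2 : ℝ) • vecMulVec (z.1 - m) (z.2 - m)) i j :=
    (HasPolyGrowth.const 2).mul (.vecMulVec (.comp_sub_fst m) (.comp_sub_snd m) i j)
  exact (HasPolyGrowth.const _).mul (((HasPolyGrowth.const 1).add ((HasPolyGrowth.const σ).mul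
    (.matrix_trace (.matrix_mul (fun i j => ((huw i j).sub (hB1 i j)).sub (hB2 i j))
      (.matrix_const _))))).add ((HasPolyGrowth.const (σ ^ 2)).mul
    (((HasPolyGrowth.matrix_trace (.matrix_mul hB1 (.matrix_const _))).mul
      (.matrix_trace (.matrix_mul hB2 (.matrix_const _)))).add
    ((HasPolyGrowth.const 2).mul (.matrix_trace (.matrix_mul (.matrix_mul (.matrix_mul hB1
      (.matrix_const _)) hB2) (.matrix_const _)))))))

/-- `f` is a quadratic polynomial, written in the variable `x - m`. -/
def IsQuadPoly (f : (Fin d → ℝ) → ℝ) : Prop :=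
  ∃ (k c : ℝ) (b : Fin d → ℝ) (R : Matrix (Fin d) (Fin d) ℝ), ∀ x, f x = k * quadPoly c b R (x - m)

lemma isQuadPoly_T2_snd (hσ : 0 < σ) (hS : S.PosDef) (x : Fin d → ℝ) :
    IsQuadPoly m (T2 σ m S x) :=
  ⟨_, _, _, _, T2_eq_quadPoly_snd m hσ hS x⟩

lemma isQuadPoly_T4_fst (hσ : 0 < σ) (hS : S.PosDef) (y : Fin d → ℝ) :
    IsQuadPoly m fun x => T4 σ m S x y :=
  ⟨_, _, _, _, fun x => T4_eq_quadPoly_fst m hσ hS x y⟩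

lemma isQuadPoly_T4_snd (hσ : 0 < σ) (hS : S.PosDef) (x : Fin d → ℝ) :
    IsQuadPoly m (T4 σ m S x) :=
  ⟨_, _, _, _, fun y => (T4_comm m hσ hS x y).trans (T4_eq_quadPoly_fst m hσ hS y x)⟩

/-- `T₂(x, ·)` is the `L²`-projection of `T₁(x, ·)` onto quadratic polynomials. -/
lemma integral_prod_T1_mul_eq (hσ : 0 < σ) (hS : S.PosDef) {g : (Fin d → ℝ) → (Fin d → ℝ) → ℝ}
    (hg : HasPolyGrowth fun z : (Fin d → ℝ) × (Fin d → ℝ) => g z.1 z.2)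
    (hq : ∀ x, IsQuadPoly m (g x)) :
    ∫ z, T1 σ z.1 z.2 * g z.1 z.2 ∂(gaussN m S).prod (gaussN m S) =
      ∫ z, T2 σ m S z.1 z.2 * g z.1 z.2 ∂(gaussN m S).prod (gaussN m S) := by
  have := isGaussian_gaussN m hS
  rw [integral_prod _ (((hasPolyGrowth_T1 hσ).mul hg).integrable _),
    integral_prod _ (((hasPolyGrowth_T2 m hσ hS).mul hg).integrable _)]
  refine integral_congr_ae (Filter.Eventually.of_forall fun x => ?_)
  obtain ⟨k, c, b, R, h⟩ := hq x
  simp only [h, mul_left_comm _ k, integral_const_mul, integral_T1_mul_quadPoly_eq m hσ hS]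

/-- `T₄(·, y)` is the `L²`-projection of `T₂(·, y)` onto quadratic polynomials. -/
lemma integral_prod_T2_mul_eq (hσ : 0 < σ) (hS : S.PosDef) {g : (Fin d → ℝ) → (Fin d → ℝ) → ℝ}
    (hg : HasPolyGrowth fun z : (Fin d → ℝ) × (Fin d → ℝ) => g z.1 z.2)
    (hq : ∀ y, IsQuadPoly m fun x => g x y) :
    ∫ z, T2 σ m S z.1 z.2 * g z.1 z.2 ∂(gaussN m S).prod (gaussN m S) =
      ∫ z, T4 σ m S z.1 z.2 * g z.1 z.2 ∂(gaussN m S).prod (gaussN m S) := by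
  have := isGaussian_gaussN m hS
  rw [integral_prod_symm _ (((hasPolyGrowth_T2 m hσ hS).mul hg).integrable _),
    integral_prod_symm _ (((hasPolyGrowth_T4 m).mul hg).integrable _)]
  refine integral_congr_ae (Filter.Eventually.of_forall fun y => ?_)
  obtain ⟨k, c, b, R, h⟩ := hq y
  simp only [h, mul_left_comm _ k, integral_const_mul, integral_T2_mul_quadPoly_eq m hσ hS]

end Kernels

/-- Reduction of the variance formula (Lemmas 7–8):
`∬ K² = ∬ T₁² − 2 ∬ T₂² + ∬ T₄²`, integrals with respect to `N(m₀,Σ₀) ⊗ N(m₀,Σ₀)`. -/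
theorem kernel_square_reduction {d : ℕ} (hd : 1 ≤ d) (σ : ℝ) (hσ : 0 < σ)
    (m₀ : Fin d → ℝ) (S : Matrix (Fin d) (Fin d) ℝ) (hS : S.PosDef) :
    ∫ y, (∫ x, (Kf σ m₀ S x y) ^ 2 ∂(gaussN m₀ S)) ∂(gaussN m₀ S) =
      (∫ y, (∫ x, (T1 σ x y) ^ 2 ∂(gaussN m₀ S)) ∂(gaussN m₀ S))
      - 2 * (∫ y, (∫ x, (T2 σ m₀ S x y) ^ 2 ∂(gaussN m₀ S)) ∂(gaussN m₀ S))
      + ∫ y, (∫ x, (T4 σ m₀ S x y) ^ 2 ∂(gaussN m₀ S)) ∂(gaussN m₀ S) := by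
  have := isGaussian_gaussN m₀ hS
  have g1 := hasPolyGrowth_T1 (d := d) hσ
  have g2 := hasPolyGrowth_T2 m₀ hσ hS
  have g3 : HasPolyGrowth fun z : (Fin d → ℝ) × (Fin d → ℝ) => T3 σ m₀ S z.1 z.2 := by
    obtain ⟨hc, C, k, h⟩ := g2
    exact ⟨hc.comp continuous_swap, C, k, fun z => by
      simpa [Prod.norm_def, max_comm, T3] using h z.swap⟩
  have g4 := hasPolyGrowth_T4 (σ := σ) (S := S) m₀
  set ν := (gaussN m₀ S).prod (gaussN m₀ S)
  have hsq {f : (Fin d → ℝ) → (Fin d → ℝ) → ℝ}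
      (hf : HasPolyGrowth fun z : (Fin d → ℝ) × (Fin d → ℝ) => f z.1 z.2) :
      ∫ y, (∫ x, f x y ^ 2 ∂(gaussN m₀ S)) ∂(gaussN m₀ S) = ∫ z, f z.1 z.2 * f z.1 z.2 ∂ν := by
    simp only [sq]
    exact (integral_prod_symm _ ((hf.mul hf).integrable _)).symm
  have hswap (f : (Fin d → ℝ) → (Fin d → ℝ) → ℝ) :
      ∫ z, f z.2 z.1 ∂ν = ∫ z, f z.1 z.2 ∂ν :=
    integral_prod_swap (fun z : (Fin d → ℝ) × (Fin d → ℝ) => f z.1 z.2)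
  have h12 := integral_prod_T1_mul_eq m₀ hσ hS g2 (isQuadPoly_T2_snd m₀ hσ hS)
  have h14 := integral_prod_T1_mul_eq m₀ hσ hS g4 (isQuadPoly_T4_snd m₀ hσ hS)
  have h24 := integral_prod_T2_mul_eq m₀ hσ hS g4 (isQuadPoly_T4_fst m₀ hσ hS)
  have h23 := integral_prod_T2_mul_eq m₀ hσ hS g3 (isQuadPoly_T2_snd m₀ hσ hS)
  have h13 : ∫ z, T1 σ z.1 z.2 * T3 σ m₀ S z.1 z.2 ∂ν =
      ∫ z, T1 σ z.1 z.2 * T2 σ m₀ S z.1 z.2 ∂ν := by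
    simpa only [T1_comm (Prod.snd _), T3] using hswap fun x y => T1 σ x y * T2 σ m₀ S x y
  have h33 : ∫ z, T3 σ m₀ S z.1 z.2 * T3 σ m₀ S z.1 z.2 ∂ν =
      ∫ z, T2 σ m₀ S z.1 z.2 * T2 σ m₀ S z.1 z.2 ∂ν :=
    hswap fun x y => T2 σ m₀ S x y * T2 σ m₀ S x y
  have h43 : ∫ z, T4 σ m₀ S z.1 z.2 * T3 σ m₀ S z.1 z.2 ∂ν =
      ∫ z, T4 σ m₀ S z.1 z.2 * T2 σ m₀ S z.1 z.2 ∂ν := by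
    simpa only [T4_comm m₀ hσ hS (Prod.snd _), T3] using
      hswap fun x y => T4 σ m₀ S x y * T2 σ m₀ S x y
  have gK : HasPolyGrowth fun z : (Fin d → ℝ) × (Fin d → ℝ) => Kf σ m₀ S z.1 z.2 :=
    ((g1.sub g2).sub g3).add g4
  have hlin {f : (Fin d → ℝ) × (Fin d → ℝ) → ℝ} (hf : HasPolyGrowth f) :
      ∫ z, f z * Kf σ m₀ S z.1 z.2 ∂ν = ∫ z, f z * T1 σ z.1 z.2 ∂ν -
        ∫ z, f z * T2 σ m₀ S z.1 z.2 ∂ν - ∫ z, f z * T3 σ m₀ S z.1 z.2 ∂ν +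
        ∫ z, f z * T4 σ m₀ S z.1 z.2 ∂ν := by
    have f1 := hf.mul g1
    have f2 := hf.mul g2
    have f3 := hf.mul g3
    have f4 := hf.mul g4
    simp only [Kf, mul_add, mul_sub]
    rw [integral_add (((f1.sub f2).sub f3).integrable ν) (f4.integrable ν),
      integral_sub ((f1.sub f2).integrable ν) (f3.integrable ν),
      integral_sub (f1.integrable ν) (f2.integrable ν)]
  have hc (f g : (Fin d → ℝ) × (Fin d → ℝ) → ℝ) : ∫ z, f z * g z ∂ν = ∫ z, g z * f z ∂ν := by
    simp only [mul_comm]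
  rw [hsq gK, hsq g1, hsq g2, hsq g4, hlin gK, hc _ fun z => T1 σ z.1 z.2,
    hc _ fun z => T2 σ m₀ S z.1 z.2, hc _ fun z => T3 σ m₀ S z.1 z.2,
    hc _ fun z => T4 σ m₀ S z.1 z.2, hlin g1, hlin g2, hlin g3, hlin g4]
  have c21 := hc (fun z => T2 σ m₀ S z.1 z.2) fun z => T1 σ z.1 z.2
  have c31 := hc (fun z => T3 σ m₀ S z.1 z.2) fun z => T1 σ z.1 z.2
  have c41 := hc (fun z => T4 σ m₀ S z.1 z.2) fun z => T1 σ z.1 z.2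
  have c32 := hc (fun z => T3 σ m₀ S z.1 z.2) fun z => T2 σ m₀ S z.1 z.2
  have c42 := hc (fun z => T4 σ m₀ S z.1 z.2) fun z => T2 σ m₀ S z.1 z.2
  have c34 := hc (fun z => T3 σ m₀ S z.1 z.2) fun z => T4 σ m₀ S z.1 z.2
  linarith
end
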